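/- arXiv:1010.5311 — 2 statements merged into one kernel-verified Lean document; each statement's English description precedes it below -/
import Mathlib

section
/- For every integer n with 4 ≤ n ≤ 12, every diamond-free family F of subsets of [n] with ∅ ∈ F has Lubell function h̄(F) ≤ 2 + ⌈n/2⌉·⌊n/2⌋/(n(n−1)). -/
open Finset

/-- The Lubell function of a family `F` of subsets of `[n]`. -/
noncomputable def lubell (n : ℕ) (F : Finset (Finset (Fin n))) : ℝ :=
  ∑ A ∈ F, (1 : ℝ) / (n.choose A.card)

/-- `F` is `D_k`-free: there are no pairwise distinct `A, B_1, …, B_k, C ∈ F`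
with `A ⊆ B_i ⊆ C` for all `i`. -/
def DkFree (n k : ℕ) (F : Finset (Finset (Fin n))) : Prop :=
  ¬ ∃ (A C : Finset (Fin n)) (B : Fin k → Finset (Fin n)),
      A ∈ F ∧ C ∈ F ∧ (∀ i, B i ∈ F) ∧
      Function.Injective B ∧ (∀ i, B i ≠ A ∧ B i ≠ C) ∧ A ≠ C ∧
      (∀ i, A ⊆ B i ∧ B i ⊆ C)

/-- Red/blue colouring of pairs with a distinguished vertex set (indicator `α`). -/
structure Col (n : ℕ) (α : Fin n → ℝ) (ρ β : Fin n → Fin n → ℝ) : Prop where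
  hα : ∀ v, α v = 0 ∨ α v = 1
  hρ : ∀ u v, ρ u v = 0 ∨ ρ u v = 1
  hρs : ∀ u v, ρ u v = ρ v u
  hd : ∀ u, ρ u u = 0
  hβ : ∀ u v, β u v = if u = v then 0 else 1 - ρ u v
  hAA : ∀ u v, u ≠ v → α u = 1 → α v = 1 → ρ u v = 1

namespace Col
variable {n : ℕ} {α : Fin n → ℝ} {ρ β : Fin n → Fin n → ℝ}

lemma b01 (h : Col n α ρ β) (u v : Fin n) : β u v = 0 ∨ β u v = 1 := by
  rw [h.hβ]; split_ifs
  · simp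
  · rcases h.hρ u v with h | h <;> simp [h]

lemma bs (h : Col n α ρ β) (u v : Fin n) : β u v = β v u := by
  rw [h.hβ, h.hβ, h.hρs u v]; simp only [eq_comm]

lemma bd (h : Col n α ρ β) (u : Fin n) : β u u = 0 := by rw [h.hβ]; simp

lemma rb (h : Col n α ρ β) (u v : Fin n) (huv : u ≠ v) : β u v = 1 - ρ u v := by
  rw [h.hβ]; simp [huv]

lemma rb0 (h : Col n α ρ β) (u v : Fin n) : ρ u v * β u v = 0 := by
  rw [h.hβ]; split_ifs
  · simp
  · rcases h.hρ u v with h | h <;> simp [h]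

lemma ρ0 (h : Col n α ρ β) (u v : Fin n) : 0 ≤ ρ u v := by
  rcases h.hρ u v with h | h <;> simp [h]
lemma β0 (h : Col n α ρ β) (u v : Fin n) : 0 ≤ β u v := by
  rcases h.b01 u v with h | h <;> simp [h]
lemma α0 (h : Col n α ρ β) (u : Fin n) : 0 ≤ α u := by
  rcases h.hα u with h | h <;> simp [h]
lemma κ0 (h : Col n α ρ β) (u : Fin n) : 0 ≤ 1 - α u := by
  rcases h.hα u with h | h <;> simp [h]
end Col

noncomputable def tri {n : ℕ} (α : Fin n → ℝ) (β : Fin n → Fin n → ℝ) (u v w : Fin n) : ℝ :=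
  (1 - α u) * (1 - α v) * (1 - α w) * β u v * β u w * β v w

noncomputable def bigQ {n : ℕ} (α : Fin n → ℝ) (β : Fin n → Fin n → ℝ) : ℝ :=
  ∑ u, ∑ v, ∑ w, ∑ x, tri α β u v w * ((1 - α x) * β u x * β v x * β w x)

noncomputable def bigP {n : ℕ} (α : Fin n → ℝ) (ρ β : Fin n → Fin n → ℝ) : ℝ :=
  ∑ u, ∑ v, ∑ x, (1 - α u) * (1 - α v) * (1 - α x) * (ρ u x * ρ v x * β u v)

noncomputable def numB {n : ℕ} (α : Fin n → ℝ) : ℝ := ∑ v, (1 - α v)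

/-- red degree into B -/
noncomputable def rB {n : ℕ} (α : Fin n → ℝ) (ρ : Fin n → Fin n → ℝ) (u : Fin n) : ℝ :=
  ∑ v, (1 - α v) * ρ u v

lemma tri_sw1 {n : ℕ} {α : Fin n → ℝ} {ρ β : Fin n → Fin n → ℝ} (h : Col n α ρ β)
    (u v w : Fin n) : tri α β u v w = tri α β v u w := by
  unfold tri; rw [h.bs u v]; ring
lemma tri_sw2 {n : ℕ} {α : Fin n → ℝ} {ρ β : Fin n → Fin n → ℝ} (h : Col n α ρ β)
    (u v w : Fin n) : tri α β u v w = tri α β u w v := by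
  unfold tri; rw [h.bs v w]; ring
lemma tri_cases {n : ℕ} {α : Fin n → ℝ} {ρ β : Fin n → Fin n → ℝ} (h : Col n α ρ β)
    (u v w : Fin n) : tri α β u v w = 0 ∨ (tri α β u v w = 1 ∧ α u = 0 ∧ α v = 0 ∧ α w = 0 ∧
      β u v = 1 ∧ β u w = 1 ∧ β v w = 1) := by
  unfold tri
  rcases h.hα u with a | a <;> rcases h.hα v with b | b <;> rcases h.hα w with c | c <;>
  rcases h.b01 u v with d | d <;> rcases h.b01 u w with e | e <;> rcases h.b01 v w with f | f <;>
  simp [a, b, c, d, e, f]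

lemma sum_excl {n : ℕ} (α : Fin n → ℝ) (u v w : Fin n) :
    ∑ x, (1 - α x) * (1 - (if x = u then 1 else 0) - (if x = v then 1 else 0)
      - (if x = w then 1 else 0)) = numB α - (1 - α u) - (1 - α v) - (1 - α w) := by
  simp only [mul_sub, mul_one, sum_sub_distrib, mul_ite, mul_zero, sum_ite_eq', mem_univ, if_true,
    numB]

lemma sw12 {n : ℕ} (f : Fin n → Fin n → Fin n → ℝ) :
    ∑ u, ∑ v, ∑ w, f u v w = ∑ u, ∑ v, ∑ w, f v u w := sum_comm
lemma sw23 {n : ℕ} (f : Fin n → Fin n → Fin n → ℝ) :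
    ∑ u, ∑ v, ∑ w, f u v w = ∑ u, ∑ v, ∑ w, f u w v :=
  sum_congr rfl fun _ _ => sum_comm
lemma sw13 {n : ℕ} (f : Fin n → Fin n → Fin n → ℝ) :
    ∑ u, ∑ v, ∑ w, f u v w = ∑ u, ∑ v, ∑ w, f w v u := by
  rw [sw12, sw23, sw12]

lemma cherry_bound {n : ℕ} {α : Fin n → ℝ} {ρ β : Fin n → Fin n → ℝ} (h : Col n α ρ β) :
    ∑ u, ∑ v, ∑ w, tri α β u v w * ∑ x, (1 - α x) * (ρ u x * ρ v x)
      ≤ (numB α - 3) * bigP α ρ β := by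
  have e : ∀ u v, ∑ w, tri α β u v w * ∑ x, (1 - α x) * (ρ u x * ρ v x) =
      ∑ x, ∑ w, tri α β u v w * ((1 - α x) * (ρ u x * ρ v x)) := by
    intro u v
    simp only [mul_sum]
    exact sum_comm
  simp only [e]
  unfold bigP
  simp only [mul_sum]
  refine sum_le_sum fun u _ => sum_le_sum fun v _ => sum_le_sum fun x _ => ?_
  have hh : ∀ w, tri α β u v w * ((1 - α x) * (ρ u x * ρ v x)) ≤
      ((1 - α u) * (1 - α v) * (1 - α x) * (ρ u x * ρ v x * β u v)) *
      ((1 - α w) * (1 - (if w = u then 1 else 0) - (if w = v then 1 else 0)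
      - (if w = x then 1 else 0))) := by
    intro w
    have hc : 0 ≤ (1 - α u) * (1 - α v) * (1 - α x) * (ρ u x * ρ v x * β u v) :=
      mul_nonneg (mul_nonneg (mul_nonneg (h.κ0 u) (h.κ0 v)) (h.κ0 x))
        (mul_nonneg (mul_nonneg (h.ρ0 _ _) (h.ρ0 _ _)) (h.β0 _ _))
    have hk := h.κ0 w
    unfold tri
    by_cases h1 : w = u
    · subst h1
      by_cases h2 : w = v
      · subst h2; simp [h.bd]
      · by_cases h3 : w = x
        · subst h3; simp [h.hd]
        · simp [h.bd, h2, h3]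
    by_cases h2 : w = v
    · subst h2
      by_cases h3 : w = x
      · subst h3; simp [h.hd]
      · simp [h.bd, h1, h3]
    by_cases h3 : w = x
    · subst h3
      simp only [h1, h2, if_true, if_false]
      have := h.rb0 u w
      have e0 : (1 - α u) * (1 - α v) * (1 - α w) * β u v * β u w * β v w *
        ((1 - α w) * (ρ u w * ρ v w)) = (1 - α u) * (1 - α v) * (1 - α w) * β u v * β v w *
        ((1 - α w) * ρ v w) * (ρ u w * β u w) := by ring
      rw [e0, this]; simp
    simp only [h1, h2, h3, if_false]
    have h4 : β u w * β v w ≤ 1 := by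
      rcases h.b01 u w with d | d <;> rcases h.b01 v w with e | e <;> simp [d, e]
    have := mul_le_mul_of_nonneg_left h4 (mul_nonneg hc hk)
    nlinarith
  refine (sum_le_sum fun w _ => hh w).trans ?_
  rw [← mul_sum, sum_excl]
  rcases h.hα u with a | a <;> rcases h.hα v with b | b <;> rcases h.hα x with c | c <;>
    simp [a, b, c]
  apply le_of_eq; ring

lemma Q_bound {n : ℕ} {α : Fin n → ℝ} {ρ β : Fin n → Fin n → ℝ} (h : Col n α ρ β) :
    bigQ α β ≤ ∑ u, (1 - α u) * ((∑ v, ∑ w, tri α β u v w) * (numB α - 3 - 3 * rB α ρ u))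
      + 3 * ((numB α - 3) * bigP α ρ β) := by
  have s1 : ∀ u v w, ∑ x, tri α β u v w * ((1 - α x) * β u x * β v x * β w x) ≤
      tri α β u v w * (numB α - 3) - tri α β u v w * rB α ρ u - tri α β u v w * rB α ρ v
      - tri α β u v w * rB α ρ w
      + tri α β u v w * (∑ x, (1 - α x) * (ρ u x * ρ v x))
      + tri α β u v w * (∑ x, (1 - α x) * (ρ u x * ρ w x))
      + tri α β u v w * (∑ x, (1 - α x) * (ρ v x * ρ w x)) := by
    intro u v w
    rcases tri_cases h u v w with h0 | ⟨h0, hu, hv, hw, huv, huw, hvw⟩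
    · simp [h0]
    · have huv' : u ≠ v := by rintro rfl; rw [h.bd] at huv; norm_num at huv
      have huw' : u ≠ w := by rintro rfl; rw [h.bd] at huw; norm_num at huw
      have hvw' : v ≠ w := by rintro rfl; rw [h.bd] at hvw; norm_num at hvw
      have q1 : ρ u v = 0 := by have := h.rb u v huv'; linarith
      have q2 : ρ u w = 0 := by have := h.rb u w huw'; linarith
      have q3 : ρ v w = 0 := by have := h.rb v w hvw'; linarith
      have q1' := h.hρs u v
      have q2' := h.hρs u w
      have q3' := h.hρs v w
      have e := sum_excl α u v w
      rw [hu, hv, hw] at e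
      have e' : numB α - 3 = numB α - (1 - 0) - (1 - 0) - (1 - 0) := by ring
      simp only [h0, one_mul]
      rw [e', ← e]
      unfold rB
      simp only [← sum_sub_distrib, ← sum_add_distrib]
      apply sum_le_sum
      intro x _
      have hk := h.κ0 x
      by_cases h1 : x = u
      · subst h1; simp [h.bd, huv', huw', h.hd, ← q1', ← q2', q1, q2]
      by_cases h2 : x = v
      · subst h2; simp [h.bd, h1, hvw', h.hd, ← q3', q1, q3]
      by_cases h3 : x = w
      · subst h3; simp [h.bd, h1, h2, h.hd, q2, q3]
      simp only [h1, h2, h3, if_false]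
      rw [h.rb u x (Ne.symm h1), h.rb v x (Ne.symm h2), h.rb w x (Ne.symm h3)]
      have : 0 ≤ (1 - α x) * (ρ u x * ρ v x * ρ w x) :=
        mul_nonneg hk (mul_nonneg (mul_nonneg (h.ρ0 _ _) (h.ρ0 _ _)) (h.ρ0 _ _))
      nlinarith
  have s2 := sum_le_sum fun u (_ : u ∈ univ) => sum_le_sum fun v (_ : v ∈ univ) =>
    sum_le_sum fun w (_ : w ∈ univ) => s1 u v w
  simp only [sum_add_distrib, sum_sub_distrib] at s2
  have r2 : ∑ u, ∑ v, ∑ w, tri α β u v w * rB α ρ v = ∑ u, ∑ v, ∑ w, tri α β u v w * rB α ρ u := by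
    rw [sw12]
    refine sum_congr rfl fun u _ => sum_congr rfl fun v _ => sum_congr rfl fun w _ => ?_
    rw [tri_sw1 h]
  have r3 : ∑ u, ∑ v, ∑ w, tri α β u v w * rB α ρ w = ∑ u, ∑ v, ∑ w, tri α β u v w * rB α ρ u := by
    rw [sw13]
    refine sum_congr rfl fun u _ => sum_congr rfl fun v _ => sum_congr rfl fun w _ => ?_
    rw [tri_sw1 h, tri_sw2 h, tri_sw1 h]
  have c1 := cherry_bound h
  have c2 : ∑ u, ∑ v, ∑ w, tri α β u v w * (∑ x, (1 - α x) * (ρ u x * ρ w x)) =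
      ∑ u, ∑ v, ∑ w, tri α β u v w * (∑ x, (1 - α x) * (ρ u x * ρ v x)) := by
    rw [sw23]
    refine sum_congr rfl fun u _ => sum_congr rfl fun v _ => sum_congr rfl fun w _ => ?_
    rw [tri_sw2 h]
  have c3 : ∑ u, ∑ v, ∑ w, tri α β u v w * (∑ x, (1 - α x) * (ρ v x * ρ w x)) =
      ∑ u, ∑ v, ∑ w, tri α β u v w * (∑ x, (1 - α x) * (ρ u x * ρ v x)) := by
    rw [sw13]
    refine sum_congr rfl fun u _ => sum_congr rfl fun v _ => sum_congr rfl fun w _ => ?_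
    rw [tri_sw1 h, tri_sw2 h, tri_sw1 h]
    simp only [mul_comm (ρ v _)]
  have m1 : ∑ u, (1 - α u) * ((∑ v, ∑ w, tri α β u v w) * (numB α - 3 - 3 * rB α ρ u)) =
      ∑ u, ∑ v, ∑ w, tri α β u v w * (numB α - 3) - 3 * ∑ u, ∑ v, ∑ w, tri α β u v w * rB α ρ u := by
    rw [mul_sum, ← sum_sub_distrib]
    refine sum_congr rfl fun u _ => ?_
    simp only [← sum_mul]
    have : (1 - α u) * (∑ v, ∑ w, tri α β u v w) = ∑ v, ∑ w, tri α β u v w := by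
      rcases h.hα u with a | a
      · simp [a]
      · simp [a, tri]
    rw [← mul_assoc, this]; ring
  unfold bigQ
  rw [m1]
  linarith

def vL (n a p q : ℤ) : ℤ :=
  4 * (n - 3) * ((p + q) * (n - 1 - p - q) - (a * (a - 1) - (a - q) * (a - q - 1)))

def vR (n a p : ℤ) : ℤ := (n - a - 1 - p) * (n - a - 2 - p) * (n - a - 3 - 3 * p)

def vM (n : ℤ) : ℤ := if n % 2 = 0 then 4 * (n - 3) * ((n / 2) * (n / 2 - 1)) else
  4 * (n - 3) * ((n / 2) * (n / 2))

lemma vert1 : ∀ n a p q : Fin 13, 4 ≤ n.val → a.val + p.val + 1 ≤ n.val → q.val ≤ a.val →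
    (vL n.val a.val p.val q.val ≤ vM n.val ∧
    vL n.val a.val p.val q.val + vR n.val a.val p.val ≤ vM n.val) := by
  decide +kernel

lemma vert2 : ∀ n a p q : Fin 13, 4 ≤ n.val → a.val + p.val + 1 ≤ n.val → q.val ≤ a.val →
    n.val % 2 = 1 →
    (q.val = 0 ∧ p.val ≠ n.val / 2 ∨ 3 ≤ a.val ∧ (p.val + q.val ≠ n.val / 2 ∨ 1 ≤ q.val)) →
    (vL n.val a.val p.val q.val + 4 * ((n.val : ℤ) - 3) ≤ vM n.val ∧
    vL n.val a.val p.val q.val + vR n.val a.val p.val + 4 * ((n.val : ℤ) - 3) ≤ vM n.val) := by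
  decide +kernel

lemma vertA1 : ∀ n r : Fin 13, 4 ≤ n.val → r.val + 1 ≤ n.val →
    4 * ((n.val : ℤ) - 3) * (r.val * (n.val - 1 - r.val)) ≤ vM n.val := by
  decide +kernel

lemma vertA2 : ∀ n r : Fin 13, 4 ≤ n.val → r.val + 1 ≤ n.val → n.val % 2 = 1 →
    r.val ≠ n.val / 2 →
    4 * ((n.val : ℤ) - 3) * (r.val * (n.val - 1 - r.val)) + 4 * ((n.val : ℤ) - 3) ≤ vM n.val := by
  decide +kernel

lemma vertI : ∀ n a x : Fin 13, 4 ≤ n.val → a.val ≤ 2 → x.val + 1 + a.val ≤ n.val →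
    n.val % 2 = 1 →
    4 * ((n.val : ℤ) - 3) * (n.val / 2 : ℤ) ≤ vM n.val
      - 4 * ((n.val : ℤ) - 3) * ((n.val - 1 - x.val) * x.val)
      + 4 * ((n.val : ℤ) - 3) * (2 * ((n.val - a.val - x.val) * x.val)) := by
  decide +kernel

lemma nat01 {n : ℕ} (f : Fin n → ℝ) (hf : ∀ x, f x = 0 ∨ f x = 1) : ∃ k : ℕ, ∑ x, f x = k := by
  refine ⟨(univ.filter fun x => f x = 1).card, ?_⟩
  rw [card_filter]
  push_cast
  apply sum_congr rfl
  intro x _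
  rcases hf x with h | h <;> simp [h]

noncomputable def rA {n : ℕ} (α : Fin n → ℝ) (ρ : Fin n → Fin n → ℝ) (u : Fin n) : ℝ :=
  ∑ v, α v * ρ u v

noncomputable def sg {n : ℕ} (α : Fin n → ℝ) (β : Fin n → Fin n → ℝ) (u : Fin n) : ℝ :=
  ∑ v, ∑ w, (if v = w then 0 else α v * α w * (1 - β u v * β u w))

section facts
variable {n : ℕ} {α : Fin n → ℝ} {ρ β : Fin n → Fin n → ℝ}

lemma r_split (u : Fin n) : ∑ v, ρ u v = rB α ρ u + rA α ρ u := by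
  unfold rB rA
  rw [← sum_add_distrib]
  exact sum_congr rfl fun _ _ => by ring

lemma b_eq (h : Col n α ρ β) (u : Fin n) : ∑ v, β u v = n - 1 - ∑ v, ρ u v := by
  have : ∀ v, β u v = 1 - (if u = v then 1 else 0) - ρ u v := by
    intro v
    rw [h.hβ]; split_ifs with hh
    · subst hh; simp [h.hd]
    · ring
  simp only [this, sum_sub_distrib]
  simp

lemma numB_eq : numB α = n - ∑ v, α v := by
  unfold numB
  simp [sum_sub_distrib]

lemma pairsum (f : Fin n → ℝ) (hf : ∀ v, f v = 0 ∨ f v = 1) :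
    ∑ v, ∑ w, (if v = w then 0 else f v * f w) = (∑ v, f v) * (∑ v, f v) - ∑ v, f v := by
  have : ∀ v w, (if v = w then 0 else f v * f w) = f v * f w - (if v = w then f v else 0) := by
    intro v w
    split_ifs with hh
    · subst hh; rcases hf v with h | h <;> simp [h]
    · ring
  simp only [this, sum_sub_distrib, sum_mul_sum]
  simp

lemma bA_eq (h : Col n α ρ β) (u : Fin n) (hu : α u = 0) :
    ∑ v, α v * β u v = ∑ v, α v - rA α ρ u := by
  unfold rA
  rw [← sum_sub_distrib]
  apply sum_congr rfl
  intro v _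
  rw [h.hβ]; split_ifs with hh
  · subst hh; simp [hu]
  · ring

lemma bB_eq (h : Col n α ρ β) (u : Fin n) (hu : α u = 0) :
    ∑ v, (1 - α v) * β u v = numB α - 1 - rB α ρ u := by
  have : ∀ v, (1 - α v) * β u v = (1 - α v) - (if v = u then 1 else 0) - (1 - α v) * ρ u v := by
    intro v
    rw [h.hβ]
    by_cases hh : u = v
    · subst hh; simp [hu, h.hd]
    · simp [hh, Ne.symm hh]; ring
  simp only [this, sum_sub_distrib, rB, numB]
  simp

lemma sg_eq (h : Col n α ρ β) (u : Fin n) (hu : α u = 0) :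
    sg α β u = (∑ v, α v) * (∑ v, α v - 1) -
      (∑ v, α v - rA α ρ u) * (∑ v, α v - rA α ρ u - 1) := by
  have e1 := pairsum α h.hα
  have e2 := pairsum (fun v => α v * β u v) (by
    intro v
    rcases h.hα v with a | a <;> rcases h.b01 u v with b | b <;> simp [a, b])
  rw [bA_eq h u hu] at e2
  have : sg α β u = ∑ v, ∑ w, (if v = w then 0 else α v * α w)
      - ∑ v, ∑ w, (if v = w then 0 else (α v * β u v) * (α w * β u w)) := by
    unfold sg
    simp only [← sum_sub_distrib]
    refine sum_congr rfl fun v _ => sum_congr rfl fun w _ => ?_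
    split_ifs <;> ring
  rw [this, e1, e2]; ring

lemma tau_nonneg (h : Col n α ρ β) (u : Fin n) : 0 ≤ ∑ v, ∑ w, tri α β u v w :=
  sum_nonneg fun v _ => sum_nonneg fun w _ => by
    rcases tri_cases h u v w with h | h
    · simp [h]
    · simp [h.1]

lemma tau_le (h : Col n α ρ β) (u : Fin n) (hu : α u = 0) : ∑ v, ∑ w, tri α β u v w ≤
    (numB α - 1 - rB α ρ u) * (numB α - 2 - rB α ρ u) := by
  have e2 := pairsum (fun v => (1 - α v) * β u v) (by
    intro v
    rcases h.hα v with a | a <;> rcases h.b01 u v with b | b <;> simp [a, b])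
  rw [bB_eq h u hu] at e2
  have : ∑ v, ∑ w, tri α β u v w ≤
      ∑ v, ∑ w, (if v = w then 0 else ((1 - α v) * β u v) * ((1 - α w) * β u w)) := by
    refine sum_le_sum fun v _ => sum_le_sum fun w _ => ?_
    unfold tri
    split_ifs with hh
    · subst hh; simp [h.bd]
    · rcases h.hα v with a | a <;> rcases h.b01 u v with b | b <;>
        rcases h.hα w with c | c <;> rcases h.b01 u w with d | d <;>
        rcases h.b01 v w with e | e <;> simp [a, b, c, d, e, hu]
  rw [e2] at this
  linarith

/-- The deficit of a vertex. -/
noncomputable def dfc {n : ℕ} (α : Fin n → ℝ) (ρ β : Fin n → Fin n → ℝ) (u : Fin n) : ℝ :=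
  (vM n : ℝ) / (4 * (n - 3)) - ((∑ v, ρ u v) * (∑ v, β u v) - (1 - α u) * sg α β u +
    (1 - α u) * ((∑ v, ∑ w, tri α β u v w) * (numB α - 3 - 3 * rB α ρ u)) / (4 * (n - 3)))

lemma combo (L M t T c : ℝ) (h1 : L ≤ M) (h2 : L + T * c ≤ M) (h0 : 0 ≤ t) (ht : t ≤ T) :
    L + t * c ≤ M := by
  rcases le_total c 0 with hc | hc
  · nlinarith
  · nlinarith

lemma nats (h : Col n α ρ β) : ∃ a : ℕ, ∑ v, α v = a := nat01 _ h.hα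
lemma natrA (h : Col n α ρ β) (u : Fin n) : ∃ a : ℕ, rA α ρ u = a := nat01 _ (by
    intro v
    rcases h.hα v with a | a <;> rcases h.hρ u v with b | b <;> simp [a, b])
lemma natrB (h : Col n α ρ β) (u : Fin n) : ∃ a : ℕ, rB α ρ u = a := nat01 _ (by
    intro v
    rcases h.hα v with a | a <;> rcases h.hρ u v with b | b <;> simp [a, b])
lemma natr (h : Col n α ρ β) (u : Fin n) : ∃ a : ℕ, ∑ v, ρ u v = a := nat01 _ (h.hρ u)

lemma r_le (h : Col n α ρ β) (u : Fin n) : ∑ v, ρ u v ≤ n - 1 := by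
  have := b_eq h u
  have h2 : 0 ≤ ∑ v, β u v := sum_nonneg fun v _ => h.β0 u v
  linarith

lemma rA_le (h : Col n α ρ β) (u : Fin n) : rA α ρ u ≤ ∑ v, α v := by
  unfold rA
  refine sum_le_sum fun v _ => ?_
  rcases h.hα v with a | a <;> rcases h.hρ u v with b | b <;> simp [a, b]

lemma rB_le (h : Col n α ρ β) (u : Fin n) (hu : α u = 0) : rB α ρ u + 1 ≤ numB α := by
  have := bB_eq h u hu
  have h2 : 0 ≤ ∑ v, (1 - α v) * β u v := sum_nonneg fun v _ => mul_nonneg (h.κ0 v) (h.β0 u v)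
  linarith

lemma dfcA (h : Col n α ρ β) (hn : 4 ≤ n) (hn2 : n ≤ 12) (u : Fin n) (hu : α u = 1) :
    0 ≤ dfc α ρ β u ∧ (n % 2 = 1 → ∑ v, ρ u v ≠ (n / 2 : ℕ) → 1 ≤ dfc α ρ β u) := by
  obtain ⟨r, hr⟩ := natr h u
  have hle := r_le h u
  rw [hr] at hle
  have hle' : r + 1 ≤ n := by
    have : (r : ℝ) + 1 ≤ n := by linarith
    exact_mod_cast this
  have hpos : (0 : ℝ) < 4 * ((n : ℝ) - 3) := by
    have : (4 : ℝ) ≤ n := by exact_mod_cast hn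
    linarith
  have hne3 : (n : ℝ) - 3 ≠ 0 := by linarith
  have e : dfc α ρ β u = ((vM n : ℝ) - 4 * (n - 3) * (r * (n - 1 - r))) / (4 * (n - 3)) := by
    unfold dfc
    rw [b_eq h u, hr, hu]
    field_simp
    ring
  constructor
  · have := vertA1 ⟨n, by omega⟩ ⟨r, by omega⟩ hn hle'
    rw [e]
    apply div_nonneg _ hpos.le
    have h2 : ((4 * ((n : ℤ) - 3) * (r * (n - 1 - r)) : ℤ) : ℝ) ≤ (vM n : ℝ) := by
      exact_mod_cast this
    push_cast at h2
    linarith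
  · intro hodd hne
    have := vertA2 ⟨n, by omega⟩ ⟨r, by omega⟩ hn hle' hodd (by
      intro hh
      apply hne
      rw [hr]
      exact_mod_cast hh)
    rw [e, le_div_iff₀ hpos]
    have h2 : ((4 * ((n : ℤ) - 3) * (r * (n - 1 - r)) + 4 * ((n : ℤ) - 3) : ℤ) : ℝ) ≤ (vM n : ℝ) := by
      exact_mod_cast this
    push_cast at h2
    linarith

lemma dfcB (h : Col n α ρ β) (hn : 4 ≤ n) (hn2 : n ≤ 12) (u : Fin n) (hu : α u = 0) :
    0 ≤ dfc α ρ β u ∧ (n % 2 = 1 → ((rA α ρ u = 0 ∧ ∑ v, ρ u v ≠ (n / 2 : ℕ)) ∨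
      (3 ≤ ∑ v, α v ∧ (∑ v, ρ u v ≠ (n / 2 : ℕ) ∨ rA α ρ u ≠ 0))) → 1 ≤ dfc α ρ β u) := by
  obtain ⟨a, ha⟩ := nats h
  obtain ⟨p, hp⟩ := natrB h u
  obtain ⟨q, hq⟩ := natrA h u
  have hqa : q ≤ a := by
    have := rA_le h u
    rw [ha, hq] at this
    exact_mod_cast this
  have hpa : a + p + 1 ≤ n := by
    have := rB_le h u hu
    rw [numB_eq, ha, hp] at this
    have : (a : ℝ) + p + 1 ≤ n := by linarith
    exact_mod_cast this
  have hpos : (0 : ℝ) < 4 * ((n : ℝ) - 3) := by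
    have : (4 : ℝ) ≤ n := by exact_mod_cast hn
    linarith
  have hne3 : (n : ℝ) - 3 ≠ 0 := by linarith
  have t0 := tau_nonneg h u
  have t1 := tau_le h u hu
  have hs : ∑ v, ρ u v = p + q := by rw [r_split (α := α), hp, hq]
  set t := ∑ v, ∑ w, tri α β u v w with ht
  rw [numB_eq, ha, hp] at t1
  have e : dfc α ρ β u = ((vM n : ℝ) - ((vL n a p q : ℤ) + t * (n - a - 3 - 3 * p)))
      / (4 * (n - 3)) := by
    unfold dfc
    rw [b_eq h u, sg_eq h u hu, hs, numB_eq, ha, hp, hq, hu, ← ht]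
    unfold vL
    push_cast
    field_simp
    ring
  constructor
  · obtain ⟨v1, v2⟩ := vert1 ⟨n, by omega⟩ ⟨a, by omega⟩ ⟨p, by omega⟩ ⟨q, by omega⟩ hn hpa hqa
    rw [e]
    apply div_nonneg _ hpos.le
    have w1 : ((vL n a p q : ℤ) : ℝ) ≤ (vM n : ℝ) := by exact_mod_cast v1
    have w2 : ((vL n a p q + vR n a p : ℤ) : ℝ) ≤ (vM n : ℝ) := by exact_mod_cast v2
    rw [Int.cast_add] at w2
    have := combo (vL n a p q) (vM n) t _ (n - a - 3 - 3 * p) w1 (by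
      refine le_trans (le_of_eq ?_) w2
      rw [vR]; push_cast; rfl) t0 (by linarith)
    linarith
  · intro hodd hne
    obtain ⟨v1, v2⟩ := vert2 ⟨n, by omega⟩ ⟨a, by omega⟩ ⟨p, by omega⟩ ⟨q, by omega⟩ hn hpa hqa hodd
      (by
        rw [hs, hq, ha] at hne
        rcases hne with ⟨h1, h2⟩ | ⟨h1, h2⟩
        · left
          have h1' : q = 0 := by exact_mod_cast h1
          refine ⟨h1', fun hh => h2 ?_⟩
          simp only at hh
          rw [h1', hh]; simp
        · right
          refine ⟨by exact_mod_cast h1, ?_⟩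
          rcases h2 with h2 | h2
          · left
            intro hh
            apply h2
            exact_mod_cast hh
          · right
            have : q ≠ 0 := by exact_mod_cast h2
            simp only
            omega)
    rw [e, le_div_iff₀ hpos]
    have w1 : ((vL n a p q + 4 * ((n : ℤ) - 3) : ℤ) : ℝ) ≤ (vM n : ℝ) := by exact_mod_cast v1
    have w2 : ((vL n a p q + vR n a p + 4 * ((n : ℤ) - 3) : ℤ) : ℝ) ≤ (vM n : ℝ) := by
      exact_mod_cast v2
    rw [Int.cast_add, Int.cast_add] at w2
    rw [Int.cast_add] at w1
    push_cast at w1 w2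
    have := combo (vL n a p q) (vM n - 4 * (n - 3)) t _ (n - a - 3 - 3 * p) (by linarith) (by
      have : ((vL n a p q : ℤ) : ℝ) + (vR n a p : ℤ) ≤ vM n - 4 * (n - 3) := by linarith
      refine le_trans (le_of_eq ?_) this
      rw [vR]; push_cast; rfl) t0 (by linarith)
    linarith

end facts

section final
variable {n : ℕ} {α : Fin n → ℝ} {ρ β : Fin n → Fin n → ℝ}

lemma dfc_nonneg (h : Col n α ρ β) (hn : 4 ≤ n) (hn2 : n ≤ 12) (u : Fin n) :
    0 ≤ dfc α ρ β u := by
  rcases h.hα u with hu | hu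
  · exact (dfcB h hn hn2 u hu).1
  · exact (dfcA h hn hn2 u hu).1

lemma bigP_nonneg (h : Col n α ρ β) : 0 ≤ bigP α ρ β :=
  sum_nonneg fun u _ => sum_nonneg fun v _ => sum_nonneg fun x _ =>
    mul_nonneg (mul_nonneg (mul_nonneg (h.κ0 u) (h.κ0 v)) (h.κ0 x))
        (mul_nonneg (mul_nonneg (h.ρ0 _ _) (h.ρ0 _ _)) (h.β0 _ _))

noncomputable def bB {n : ℕ} (α : Fin n → ℝ) (β : Fin n → Fin n → ℝ) (u : Fin n) : ℝ :=
  ∑ v, (1 - α v) * β u v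

lemma bB_nonneg (h : Col n α ρ β) (u : Fin n) : 0 ≤ bB α β u :=
  sum_nonneg fun v _ => mul_nonneg (h.κ0 v) (h.β0 u v)
lemma rB_nonneg (h : Col n α ρ β) (u : Fin n) : 0 ≤ rB α ρ u :=
  sum_nonneg fun v _ => mul_nonneg (h.κ0 v) (h.ρ0 u v)
lemma rA_nonneg (h : Col n α ρ β) (u : Fin n) : 0 ≤ rA α ρ u :=
  sum_nonneg fun v _ => mul_nonneg (h.α0 v) (h.ρ0 u v)

lemma bB_of_A (h : Col n α ρ β) (u : Fin n) (hu : α u = 1) : bB α β u = ∑ v, β u v := by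
  unfold bB
  apply sum_congr rfl
  intro v _
  by_cases hv : u = v
  · subst hv; simp [h.bd]
  · rcases h.hα v with a | a
    · simp [a]
    · rw [h.rb u v hv, h.hAA u v hv hu a]; simp

lemma bB_add_rB (h : Col n α ρ β) (u : Fin n) (hu : α u = 1) :
    bB α β u + rB α ρ u = numB α := by
  unfold bB rB numB
  rw [← sum_add_distrib]
  apply sum_congr rfl
  intro v _
  by_cases hv : u = v
  · subst hv; simp [hu]
  · rw [h.rb u v hv]; ring

lemma caseI (h : Col n α ρ β) (hn : 4 ≤ n) (hn2 : n ≤ 12) (hodd : n % 2 = 1)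
    (ha : ∑ v, α v ≤ 2) (i : Fin n) (hi : α i = 1) (hr : rB α ρ i ≠ 0) :
    ((n / 2 : ℕ) : ℝ) ≤ dfc α ρ β i + 2 * (rB α ρ i * bB α β i) := by
  obtain ⟨a, haa⟩ := nats h
  obtain ⟨p, hp⟩ := natrB h i
  obtain ⟨x, hx⟩ : ∃ a : ℕ, bB α β i = a := nat01 _ (by
    intro v
    rcases h.hα v with a | a <;> rcases h.b01 i v with b | b <;> simp [a, b])
  have e1 := bB_add_rB h i hi
  have e2 := bB_of_A h i hi
  have e3 := b_eq h i
  rw [numB_eq, haa, hx, hp] at e1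
  rw [hp] at hr
  have hp0 : p ≠ 0 := by exact_mod_cast hr
  have e1' : x + p + a = n := by
    have : (x : ℝ) + p + a = n := by linarith
    exact_mod_cast this
  have ha2 : a ≤ 2 := by
    rw [haa] at ha
    exact_mod_cast ha
  have hpos : (0 : ℝ) < 4 * ((n : ℝ) - 3) := by
    have : (4 : ℝ) ≤ n := by exact_mod_cast hn
    linarith
  have hne3 : (n : ℝ) - 3 ≠ 0 := by linarith
  have v := vertI ⟨n, by omega⟩ ⟨a, by omega⟩ ⟨x, by omega⟩ hn ha2 (by simp only; omega) hodd
  obtain ⟨k, hk⟩ : ∃ k, n / 2 = k := ⟨_, rfl⟩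
  have hkz : (n : ℤ) / 2 = k := by omega
  simp only [hkz] at v
  have w : ((4 * ((n : ℤ) - 3) * (k : ℤ) : ℤ) : ℝ) ≤ ((vM n
      - 4 * ((n : ℤ) - 3) * ((n - 1 - x) * x)
      + 4 * ((n : ℤ) - 3) * (2 * ((n - a - x) * x)) : ℤ) : ℝ) := by exact_mod_cast v
  push_cast at w
  have hrr : ∑ v, ρ i v = n - 1 - x := by rw [← hx, e2, e3]; ring
  have hpr : (p : ℝ) = n - a - x := by linarith
  have e : dfc α ρ β i + 2 * (rB α ρ i * bB α β i) = (vM n - 4 * ((n : ℝ) - 3) * ((n - 1 - x) * x)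
      + 4 * ((n : ℝ) - 3) * (2 * ((n - a - x) * x))) / (4 * (n - 3)) := by
    unfold dfc
    rw [← e2, hx, hrr, hp, hpr, hi]
    field_simp
    ring
  rw [e, le_div_iff₀ hpos, hk]
  linarith

lemma common_red (h : Col n α ρ β) (u v : Fin n) (hb : β u v = 1)
    (hu : 2 * ∑ x, ρ u x = n - 1) (hv : 2 * ∑ x, ρ v x = n - 1) :
    1 ≤ ∑ x, ρ u x * ρ v x := by
  have huv : u ≠ v := by rintro rfl; rw [h.bd] at hb; norm_num at hb
  have r0 : ρ u v = 0 := by have := h.rb u v huv; linarith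
  have key : ∑ x, (ρ u x + ρ v x - 1 + (if x = u then 1 else 0) + (if x = v then 1 else 0))
      ≤ ∑ x, ρ u x * ρ v x := by
    refine sum_le_sum fun x _ => ?_
    by_cases h1 : x = u
    · subst h1; simp [h.hd, huv, h.hρs v x, r0]
    by_cases h2 : x = v
    · subst h2; simp [h.hd, h1, r0]
    simp only [h1, h2, if_false]
    rcases h.hρ u x with a | a <;> rcases h.hρ v x with b | b <;> simp [a, b]
  simp only [sum_add_distrib, sum_sub_distrib] at key
  simp at key
  linarith

lemma oddFinal (h : Col n α ρ β) (hn : 4 ≤ n) (hn2 : n ≤ 12) (hodd : n % 2 = 1) :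
    ((n / 2 : ℕ) : ℝ) ≤ ∑ u, dfc α ρ β u + bigP α ρ β
      + 2 * ∑ u, α u * (rB α ρ u * bB α β u) := by
  have hP := bigP_nonneg h
  have hX : ∀ u, 0 ≤ α u * (rB α ρ u * bB α β u) := fun u =>
    mul_nonneg (h.α0 u) (mul_nonneg (rB_nonneg h u) (bB_nonneg h u))
  have hD := dfc_nonneg h hn hn2
  by_cases hI : ∑ v, α v ≤ 2 ∧ ∃ i, α i = 1 ∧ rB α ρ i ≠ 0
  · obtain ⟨ha, i, hi, hr⟩ := hI
    have c := caseI h hn hn2 hodd ha i hi hr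
    have c1 := single_le_sum (f := dfc α ρ β) (fun u _ => hD u) (mem_univ i)
    have c2 := single_le_sum (f := fun u => α u * (rB α ρ u * bB α β u)) (fun u _ => hX u)
      (mem_univ i)
    simp only [hi, one_mul] at c2
    linarith
  · have hII : 3 ≤ ∑ v, α v ∨ ∀ i, α i = 1 → rB α ρ i = 0 := by
      by_contra hcon
      push Not at hcon
      apply hI
      refine ⟨?_, hcon.2⟩
      obtain ⟨a, haa⟩ := nats h
      rw [haa] at hcon ⊢
      have : a < 3 := by exact_mod_cast hcon.1
      have : a ≤ 2 := by omega
      exact_mod_cast this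
    set m := n / 2 with hm
    have hnm : n = 2 * m + 1 := by omega
    have hnR : (n : ℝ) = 2 * m + 1 := by rw [hnm]; push_cast; ring
    classical
    set Z := univ.filter (fun u => ∑ v, ρ u v = (m : ℝ) ∧ (α u = 0 → rA α ρ u = 0)) with hZ
    have hZr : ∀ u ∈ Z, ∑ v, ρ u v = (m : ℝ) := fun u hu => (mem_filter.mp hu).2.1
    have hZA : ∀ u ∈ Z, α u = 0 → rA α ρ u = 0 := fun u hu => (mem_filter.mp hu).2.2
    -- deficits off Z
    have d1 : ∀ u ∉ Z, 1 ≤ dfc α ρ β u := by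
      intro u hu
      have hu' : ∑ v, ρ u v = (m : ℝ) → ¬ (α u = 0 → rA α ρ u = 0) := by
        intro h1 h2
        exact hu (mem_filter.mpr ⟨mem_univ _, h1, h2⟩)
      rcases h.hα u with a | a
      · apply (dfcB h hn hn2 u a).2 hodd
        by_cases hq : rA α ρ u = 0
        · left
          exact ⟨hq, fun hh => hu' hh (fun _ => hq)⟩
        · right
          refine ⟨?_, Or.inr hq⟩
          rcases hII with h3 | h3
          · exact h3
          · exfalso
            apply hq
            unfold rA
            apply sum_eq_zero
            intro v _
            rcases h.hα v with b | b
            · simp [b]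
            · have h4 := h3 v b
              unfold rB at h4
              rw [sum_eq_zero_iff_of_nonneg (fun v' _ => mul_nonneg (h.κ0 v') (h.ρ0 v v'))] at h4
              have h5 := h4 u (mem_univ u)
              rw [a, h.hρs] at h5
              simp only [sub_zero, one_mul] at h5
              rw [h5, mul_zero]
      · apply (dfcA h hn hn2 u a).2 hodd
        intro hh
        exact hu' hh (fun h0 => by rw [a] at h0; norm_num at h0)
    have d2 : (n : ℝ) - Z.card ≤ ∑ u, dfc α ρ β u := by
      have : ∑ u, (1 - (if u ∈ Z then (1 : ℝ) else 0)) ≤ ∑ u, dfc α ρ β u := by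
        refine sum_le_sum fun u _ => ?_
        split_ifs with hz
        · simpa using hD u
        · simpa using d1 u hz
      rw [sum_sub_distrib] at this
      simpa using this
    -- blue pairs in Z
    have b1 : ∀ u ∈ Z, (Z.card : ℝ) - 1 - m ≤ ∑ v ∈ Z, β u v := by
      intro u hu
      have e : ∀ v, β u v = 1 - (if u = v then 1 else 0) - ρ u v := by
        intro v
        rw [h.hβ]; split_ifs with hh
        · subst hh; simp [h.hd]
        · ring
      simp only [e, sum_sub_distrib, sum_ite_eq, hu, if_true]
      have : ∑ v ∈ Z, ρ u v ≤ ∑ v, ρ u v :=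
        sum_le_sum_of_subset_of_nonneg (subset_univ _) (fun v _ _ => h.ρ0 u v)
      rw [hZr u hu] at this
      simp
      linarith
    have b2 : (Z.card : ℝ) * ((Z.card : ℝ) - 1 - m) ≤ ∑ u ∈ Z, ∑ v ∈ Z, β u v := by
      have := sum_le_sum b1
      rw [sum_const, nsmul_eq_mul] at this
      exact this
    have ρα : ∀ u ∈ Z, α u = 0 → ∀ x, ρ u x = (1 - α x) * ρ u x := by
      intro u hu a x
      have h1 := hZA u hu a
      unfold rA at h1
      rw [sum_eq_zero_iff_of_nonneg (fun v' _ => mul_nonneg (h.α0 v') (h.ρ0 u v'))] at h1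
      have := h1 x (mem_univ x)
      linarith
    let g : Fin n → Fin n → ℝ := fun u v =>
      ∑ x, (1 - α u) * (1 - α v) * (1 - α x) * (ρ u x * ρ v x * β u v)
      + α u * (rB α ρ u * ((1 - α v) * β u v)) + α v * (rB α ρ v * ((1 - α u) * β v u))
    have g0 : ∀ u v, 0 ≤ g u v := by
      intro u v
      refine add_nonneg (add_nonneg (sum_nonneg fun x _ => ?_) ?_) ?_
      · exact mul_nonneg (mul_nonneg (mul_nonneg (h.κ0 u) (h.κ0 v)) (h.κ0 x))
          (mul_nonneg (mul_nonneg (h.ρ0 _ _) (h.ρ0 _ _)) (h.β0 _ _))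
      · exact mul_nonneg (h.α0 u) (mul_nonneg (rB_nonneg h u) (mul_nonneg (h.κ0 v) (h.β0 _ _)))
      · exact mul_nonneg (h.α0 v) (mul_nonneg (rB_nonneg h v) (mul_nonneg (h.κ0 u) (h.β0 _ _)))
    have hlow : ∀ u ∈ Z, ∀ v ∈ Z, α u = 1 → α v = 0 → β u v = 1 → 1 ≤ rB α ρ u := by
      intro u hu v hv a b hb
      have c := common_red h u v hb (by rw [hZr u hu, hnR]; ring) (by rw [hZr v hv, hnR]; ring)
      refine c.trans ?_
      unfold rB
      refine sum_le_sum fun x _ => ?_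
      rw [ρα v hv b x]
      have hk := h.κ0 x
      rcases h.hρ u x with c | c <;> rcases h.hρ v x with d | d <;> simp [c, d] <;> linarith
    have g1 : ∀ u ∈ Z, ∀ v ∈ Z, β u v ≤ g u v := by
      intro u hu v hv
      rcases h.b01 u v with hb | hb
      · rw [hb]; exact g0 u v
      rw [hb]
      have hb' : β v u = 1 := by rw [h.bs]; exact hb
      rcases h.hα u with a | a <;> rcases h.hα v with b | b
      · have c := common_red h u v hb (by rw [hZr u hu, hnR]; ring) (by rw [hZr v hv, hnR]; ring)
        simp only [g, a, b, hb, sub_zero, one_mul, mul_one, zero_mul, add_zero]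
        refine c.trans (le_of_eq (sum_congr rfl fun x _ => ?_))
        conv_lhs => rw [ρα u hu a x]
        ring
      · have := hlow v hv u hu b a hb'
        simp only [g, a, b, hb, hb', sub_zero, one_mul, mul_one, zero_mul, sub_self, mul_zero,
          sum_const_zero, zero_add]
        exact this
      · have := hlow u hu v hv a b hb
        simp only [g, a, b, hb, hb', sub_zero, one_mul, mul_one, zero_mul, sub_self, mul_zero,
          sum_const_zero, zero_add, add_zero]
        exact this
      · exfalso
        have huv : u ≠ v := by rintro rfl; rw [h.bd] at hb; norm_num at hb
        have h1 := h.hAA u v huv a b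
        have h2 := h.rb u v huv
        linarith
    have g2 : ∑ u ∈ Z, ∑ v ∈ Z, β u v ≤ ∑ u, ∑ v, g u v := by
      calc ∑ u ∈ Z, ∑ v ∈ Z, β u v ≤ ∑ u ∈ Z, ∑ v ∈ Z, g u v :=
            sum_le_sum fun u hu => sum_le_sum fun v hv => g1 u hu v hv
        _ ≤ ∑ u ∈ Z, ∑ v, g u v := sum_le_sum fun u _ =>
            sum_le_sum_of_subset_of_nonneg (subset_univ _) (fun v _ _ => g0 u v)
        _ ≤ ∑ u, ∑ v, g u v := sum_le_sum_of_subset_of_nonneg (subset_univ _)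
            (fun u _ _ => sum_nonneg fun v _ => g0 u v)
    have g3 : ∑ u, ∑ v, g u v = bigP α ρ β + 2 * ∑ u, α u * (rB α ρ u * bB α β u) := by
      simp only [g, sum_add_distrib]
      have e1 : ∑ u, ∑ v, α v * (rB α ρ v * ((1 - α u) * β v u)) =
          ∑ u, α u * (rB α ρ u * bB α β u) := by
        rw [sum_comm]
        unfold bB
        simp only [mul_sum]
      have e2 : ∑ u, ∑ v, α u * (rB α ρ u * ((1 - α v) * β u v)) =
          ∑ u, α u * (rB α ρ u * bB α β u) := by
        unfold bB
        simp only [mul_sum]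
      rw [e1, e2]
      unfold bigP
      ring
    have hXs : 0 ≤ ∑ u, α u * (rB α ρ u * bB α β u) := sum_nonneg fun u _ => hX u
    rcases Nat.lt_or_ge Z.card (m + 1) with hz | hz
    · have : (Z.card : ℝ) ≤ m := by exact_mod_cast (by omega : Z.card ≤ m)
      linarith
    · have hz' : (m : ℝ) + 1 ≤ Z.card := by exact_mod_cast hz
      have hm0 : (0 : ℝ) ≤ m := by positivity
      have : 0 ≤ ((Z.card : ℝ) - 1 - m) * (Z.card - 1) :=
        mul_nonneg (by linarith) (by linarith)
      nlinarith

lemma core (h : Col n α ρ β) (hn : 4 ≤ n) (hn2 : n ≤ 12) :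
    ∑ u, (∑ v, ρ u v) * (∑ v, β u v) - 2 * bigP α ρ β - ∑ u, (1 - α u) * sg α β u
      - 2 * ∑ u, α u * (rB α ρ u * bB α β u) + bigQ α β / (4 * (n - 3))
      ≤ (((n + 1) / 2 : ℕ) : ℝ) * ((n / 2 : ℕ) : ℝ) * (n - 2) := by
  have hpos : (0 : ℝ) < 4 * ((n : ℝ) - 3) := by
    have : (4 : ℝ) ≤ n := by exact_mod_cast hn
    linarith
  have hne3 : (n : ℝ) - 3 ≠ 0 := by linarith
  have hP := bigP_nonneg h
  have hXs : 0 ≤ ∑ u, α u * (rB α ρ u * bB α β u) := sum_nonneg fun u _ =>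
    mul_nonneg (h.α0 u) (mul_nonneg (rB_nonneg h u) (bB_nonneg h u))
  have hQ := Q_bound h
  have hB : numB α ≤ n := by
    rw [numB_eq]
    have : 0 ≤ ∑ v, α v := sum_nonneg fun v _ => h.α0 v
    linarith
  have hQ2 : bigQ α β / (4 * (n - 3)) ≤
      (∑ u, (1 - α u) * ((∑ v, ∑ w, tri α β u v w) * (numB α - 3 - 3 * rB α ρ u)) / (4 * (n - 3)))
      + bigP α ρ β := by
    rw [← sum_div, div_add' _ _ _ hpos.ne']
    apply div_le_div_of_nonneg_right _ hpos.le
    nlinarith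
  have hD : ∑ u, dfc α ρ β u = n * ((vM n : ℝ) / (4 * (n - 3))) -
      (∑ u, (∑ v, ρ u v) * (∑ v, β u v) - ∑ u, (1 - α u) * sg α β u +
      ∑ u, (1 - α u) * ((∑ v, ∑ w, tri α β u v w) * (numB α - 3 - 3 * rB α ρ u)) / (4 * (n - 3))) := by
    unfold dfc
    simp only [sum_sub_distrib, sum_add_distrib]
    simp
  rcases Nat.mod_two_eq_zero_or_one n with hpar | hpar
  · have hD0 : 0 ≤ ∑ u, dfc α ρ β u := sum_nonneg fun u _ => dfc_nonneg h hn hn2 u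
    have hv : n * ((vM n : ℝ) / (4 * (n - 3))) =
        (((n + 1) / 2 : ℕ) : ℝ) * ((n / 2 : ℕ) : ℝ) * (n - 2) := by
      obtain ⟨k, hk⟩ : ∃ k, n = 2 * k := ⟨n / 2, by omega⟩
      have h1 : (n + 1) / 2 = k := by omega
      have h2 : n / 2 = k := by omega
      have h3 : ((n : ℤ) / 2) = k := by omega
      have h4 : (n : ℤ) % 2 = 0 := by omega
      have h5 : (n : ℝ) = 2 * k := by rw [hk]; push_cast; ring
      rw [h1, h2, vM, if_pos h4, h3]
      push_cast
      rw [mul_div_cancel_left₀ _ hpos.ne', h5]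
      ring
    linarith
  · have hD0 := oddFinal h hn hn2 hpar
    have hv : n * ((vM n : ℝ) / (4 * (n - 3))) =
        (((n + 1) / 2 : ℕ) : ℝ) * ((n / 2 : ℕ) : ℝ) * (n - 2) + ((n / 2 : ℕ) : ℝ) := by
      obtain ⟨k, hk⟩ : ∃ k, n = 2 * k + 1 := ⟨n / 2, by omega⟩
      have h1 : (n + 1) / 2 = k + 1 := by omega
      have h2 : n / 2 = k := by omega
      have h3 : ((n : ℤ) / 2) = k := by omega
      have h4 : ¬ (n : ℤ) % 2 = 0 := by omega
      have h5 : (n : ℝ) = 2 * k + 1 := by rw [hk]; push_cast; ring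
      rw [h1, h2, vM, if_neg h4, h3]
      push_cast
      rw [mul_div_cancel_left₀ _ hpos.ne', h5]
      ring
    linarith

end final

/-- Weight of `X` in the interval `[t, V]`. -/
noncomputable def iw {α : Type*} (V t X : Finset α) : ℝ :=
  1 / ((V.card - t.card).choose (X.card - t.card) : ℝ)

lemma iw_nonneg {α : Type*} (V t X : Finset α) : 0 ≤ iw V t X := by
  unfold iw; positivity

lemma iw_step {α : Type*} [DecidableEq α] (V t X : Finset α) (h1 : t ⊆ X) (h2 : X ⊂ V) :
    ∑ x ∈ (V \ t).filter (fun x => x ∉ X), iw (V.erase x) t X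
      = ((V.card - t.card : ℕ) : ℝ) * iw V t X := by
  have hf : (V \ t).filter (fun x => x ∉ X) = V \ X := by
    ext x
    simp only [mem_filter, mem_sdiff]
    constructor
    · rintro ⟨⟨a, _⟩, c⟩; exact ⟨a, c⟩
    · rintro ⟨a, c⟩; exact ⟨⟨a, fun h => c (h1 h)⟩, c⟩
  have hc : ∀ x ∈ V \ X, iw (V.erase x) t X =
      1 / ((V.card - t.card - 1).choose (X.card - t.card) : ℝ) := by
    intro x hx
    have hxV : x ∈ V := (mem_sdiff.mp hx).1
    unfold iw
    rw [card_erase_of_mem hxV]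
    congr 3
    omega
  rw [hf, sum_congr rfl hc, sum_const, card_sdiff_of_subset h2.1]
  have hlt := card_lt_card h2
  have hle := card_le_card h1
  obtain ⟨k, hk⟩ : ∃ k, V.card - t.card = k + 1 := ⟨V.card - t.card - 1, by omega⟩
  obtain ⟨j, hj⟩ : ∃ j, X.card - t.card = j := ⟨_, rfl⟩
  have hjk : j ≤ k := by omega
  have hVX : V.card - X.card = k + 1 - j := by omega
  unfold iw
  rw [hk, hj, hVX]
  simp only [Nat.add_sub_cancel, nsmul_eq_mul]
  have e := Nat.add_one_mul_choose_eq k j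
  have e2 := Nat.choose_mul_succ_eq k j
  have p1 : (0 : ℝ) < (k.choose j : ℝ) := by exact_mod_cast Nat.choose_pos hjk
  have p2 : (0 : ℝ) < ((k + 1).choose j : ℝ) := by exact_mod_cast Nat.choose_pos (by omega)
  rw [mul_one_div, mul_one_div, div_eq_div_iff p1.ne' p2.ne']
  have : (k.choose j * (k + 1) : ℕ) = ((k + 1).choose j * (k + 1 - j) : ℕ) := e2
  have h' : ((k.choose j * (k + 1) : ℕ) : ℝ) = (((k + 1).choose j * (k + 1 - j) : ℕ) : ℝ) := by
    rw [this]
  push_cast [Nat.cast_sub (show j ≤ k + 1 by omega)] at h' ⊢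
  linarith

/-- Bonferroni version of the LYM inequality in an interval. -/
lemma bonf {α : Type*} [DecidableEq α] (t : Finset α) : ∀ (k : ℕ) (V : Finset α), t ⊆ V →
    V.card - t.card = k → ∀ G : Finset (Finset α), (∀ X ∈ G, t ⊆ X ∧ X ⊆ V) →
    ∑ X ∈ G, iw V t X ≤
      1 + ∑ C ∈ G, ∑ S ∈ G.filter (fun S => S ⊂ C), iw V t C * iw C t S := by
  intro k
  induction k with
  | zero =>
    intro V htV hk G hG
    have hVt : V = t := by
      symm; apply eq_of_subset_of_card_le htV; omega
    have hG1 : G ⊆ {t} := by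
      intro X hX
      have := hG X hX
      rw [hVt] at this
      simp [Subset.antisymm this.2 this.1]
    have h1 : ∑ X ∈ G, iw V t X ≤ ∑ X ∈ ({t} : Finset (Finset α)), iw V t X :=
      sum_le_sum_of_subset_of_nonneg hG1 (fun _ _ _ => iw_nonneg _ _ _)
    have h2 : ∑ X ∈ ({t} : Finset (Finset α)), iw V t X = 1 := by
      simp [iw]
    have h3 : 0 ≤ ∑ C ∈ G, ∑ S ∈ G.filter (fun S => S ⊂ C), iw V t C * iw C t S :=
      sum_nonneg fun _ _ => sum_nonneg fun _ _ => mul_nonneg (iw_nonneg _ _ _) (iw_nonneg _ _ _)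
    linarith
  | succ k ih =>
    intro V htV hk G hG
    by_cases hV : V ∈ G
    · have hw : iw V t V = 1 := by simp [iw]
      have hfil : G.filter (fun S => S ⊂ V) = G.erase V := by
        ext S
        simp only [mem_filter, mem_erase]
        constructor
        · rintro ⟨a, b⟩; exact ⟨b.ne, a⟩
        · rintro ⟨a, b⟩; exact ⟨b, (hG S b).2.ssubset_of_ne a⟩
      have h1 := single_le_sum (s := G)
        (f := fun C => ∑ S ∈ G.filter (fun S => S ⊂ C), iw V t C * iw C t S)
        (fun C _ => sum_nonneg fun _ _ => mul_nonneg (iw_nonneg _ _ _) (iw_nonneg _ _ _)) hV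
      simp only [hfil, hw, one_mul] at h1
      rw [← add_sum_erase G _ hV, hw]
      linarith
    · have hss : ∀ X ∈ G, X ⊂ V := fun X hX =>
        (hG X hX).2.ssubset_of_ne (fun h => hV (h ▸ hX))
      have key : ∑ x ∈ V \ t, ∑ X ∈ G.filter (fun X => x ∉ X), iw (V.erase x) t X ≤
          ∑ x ∈ V \ t, (1 + ∑ C ∈ G.filter (fun X => x ∉ X), ∑ S ∈ G.filter (fun S => S ⊂ C),
            iw (V.erase x) t C * iw C t S) := by
        apply sum_le_sum
        intro x hx
        rw [mem_sdiff] at hx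
        have h := ih (V.erase x) (subset_erase.mpr ⟨htV, hx.2⟩)
          (by rw [card_erase_of_mem hx.1]; omega) (G.filter (fun X => x ∉ X))
          (by
            intro X hX
            rw [mem_filter] at hX
            exact ⟨(hG X hX.1).1, subset_erase.mpr ⟨(hG X hX.1).2, hX.2⟩⟩)
        refine h.trans (le_of_eq ?_)
        congr 1
        apply sum_congr rfl
        intro C hC
        apply sum_congr _ (fun _ _ => rfl)
        ext S
        simp only [mem_filter] at hC ⊢
        constructor
        · rintro ⟨⟨a, _⟩, b⟩; exact ⟨a, b⟩
        · rintro ⟨a, b⟩; exact ⟨⟨a, fun h => hC.2 (b.1 h)⟩, b⟩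
      have swap : ∀ f : α → Finset α → ℝ,
          ∑ x ∈ V \ t, ∑ X ∈ G.filter (fun X => x ∉ X), f x X =
          ∑ X ∈ G, ∑ x ∈ (V \ t).filter (fun x => x ∉ X), f x X := by
        intro f
        simp only [sum_filter]
        exact sum_comm
      rw [sum_add_distrib, swap, swap] at key
      have e1 : ∑ X ∈ G, ∑ x ∈ (V \ t).filter (fun x => x ∉ X), iw (V.erase x) t X
          = ((k + 1 : ℕ) : ℝ) * ∑ X ∈ G, iw V t X := by
        rw [mul_sum]
        apply sum_congr rfl
        intro X hX
        rw [iw_step V t X (hG X hX).1 (hss X hX), hk]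
      have e2 : ∑ C ∈ G, ∑ x ∈ (V \ t).filter (fun x => x ∉ C),
            ∑ S ∈ G.filter (fun S => S ⊂ C), iw (V.erase x) t C * iw C t S
          = ((k + 1 : ℕ) : ℝ) * ∑ C ∈ G, ∑ S ∈ G.filter (fun S => S ⊂ C),
            iw V t C * iw C t S := by
        rw [mul_sum]
        apply sum_congr rfl
        intro C hC
        simp only [← mul_sum, ← sum_mul]
        rw [iw_step V t C (hG C hC).1 (hss C hC), hk, mul_assoc]
      rw [e1, e2] at key
      have e3 : ∑ x ∈ V \ t, (1 : ℝ) = ((k + 1 : ℕ) : ℝ) := by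
        rw [sum_const, card_sdiff_of_subset htV, hk]; simp
      rw [e3] at key
      have hpos : (0 : ℝ) < ((k + 1 : ℕ) : ℝ) := by positivity
      nlinarith

section partTwo

/-- Number of singletons and pairs inside a triple. -/
noncomputable def triU {n : ℕ} (α : Fin n → ℝ) (ε : Fin n → Fin n → ℝ) (u v w : Fin n) : ℝ :=
  α u + α v + α w + ε u v + ε u w + ε v w

noncomputable def d3 {n : ℕ} (u v w : Fin n) : ℝ := if u ≠ v ∧ u ≠ w ∧ v ≠ w then 1 else 0

noncomputable def rhoOf {n : ℕ} (α : Fin n → ℝ) (ε : Fin n → Fin n → ℝ) (u v : Fin n) : ℝ :=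
  if u = v then 0 else
    (1 - α u) * (1 - α v) * ε u v + (1 - (1 - α u) * (1 - α v)) * (1 - ε u v)

noncomputable def betaOf {n : ℕ} (α : Fin n → ℝ) (ε : Fin n → Fin n → ℝ) (u v : Fin n) : ℝ :=
  if u = v then 0 else 1 - rhoOf α ε u v

/-- non-edge indicator -/
noncomputable def nonE {n : ℕ} (ε : Fin n → Fin n → ℝ) (u v : Fin n) : ℝ :=
  if u = v then 0 else 1 - ε u v

noncomputable def psi {n : ℕ} (α : Fin n → ℝ) (ρ β : Fin n → Fin n → ℝ) (u v w : Fin n) : ℝ :=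
  (ρ u v * β u w + β u v * ρ u w) / 2
    - 2 * ((1 - α u) * (1 - α v) * (1 - α w) * (ρ u v * ρ u w * β v w))
    - (1 - α u) * (if v = w then 0 else α v * α w * (1 - β u v * β u w))
    - α u * (1 - α v) * (1 - α w) * (ρ u v * β u w + β u v * ρ u w)

lemma pointwise (a b c e f g : ℝ) (ha : a = 0 ∨ a = 1) (hb : b = 0 ∨ b = 1) (hc : c = 0 ∨ c = 1)
    (he : e = 0 ∨ e = 1) (hf : f = 0 ∨ f = 1) (hg : g = 0 ∨ g = 1)
    (h1 : a = 1 → b = 1 → e = 0) (h2 : a = 1 → c = 1 → f = 0) (h3 : b = 1 → c = 1 → g = 0)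
    (r1 r2 r3 : ℝ) (hr1 : r1 = (1 - a) * (1 - b) * e + (1 - (1 - a) * (1 - b)) * (1 - e))
    (hr2 : r2 = (1 - a) * (1 - c) * f + (1 - (1 - a) * (1 - c)) * (1 - f))
    (hr3 : r3 = (1 - b) * (1 - c) * g + (1 - (1 - b) * (1 - c)) * (1 - g)) :
    (a + b + c + e + f + g) + 3 * (if a + b + c + e + f + g ≤ 1 then (1 : ℝ) else 0) - 3 ≤
    ((r1 * (1 - r2) + (1 - r1) * r2) / 2 - 2 * ((1 - a) * (1 - b) * (1 - c) * (r1 * r2 * (1 - r3)))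
      - (1 - a) * (b * c * (1 - (1 - r1) * (1 - r2)))
      - a * (1 - b) * (1 - c) * (r1 * (1 - r2) + (1 - r1) * r2)) +
    ((r1 * (1 - r3) + (1 - r1) * r3) / 2 - 2 * ((1 - b) * (1 - a) * (1 - c) * (r1 * r3 * (1 - r2)))
      - (1 - b) * (a * c * (1 - (1 - r1) * (1 - r3)))
      - b * (1 - a) * (1 - c) * (r1 * (1 - r3) + (1 - r1) * r3)) +
    ((r3 * (1 - r2) + (1 - r3) * r2) / 2 - 2 * ((1 - c) * (1 - b) * (1 - a) * (r3 * r2 * (1 - r1)))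
      - (1 - c) * (b * a * (1 - (1 - r3) * (1 - r2)))
      - c * (1 - b) * (1 - a) * (r3 * (1 - r2) + (1 - r3) * r2)) := by
  subst hr1 hr2 hr3
  rcases ha with rfl | rfl <;> rcases hb with rfl | rfl <;> rcases hc with rfl | rfl <;>
  rcases he with rfl | rfl <;> rcases hf with rfl | rfl <;> rcases hg with rfl | rfl <;>
  first
  | (exfalso; revert h1 h2 h3; norm_num; done)
  | (clear h1 h2 h3; norm_num)

variable {n : ℕ} {α : Fin n → ℝ} {ε : Fin n → Fin n → ℝ}

lemma colOf (hα : ∀ u, α u = 0 ∨ α u = 1) (hε : ∀ u v, ε u v = 0 ∨ ε u v = 1)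
    (hs : ∀ u v, ε u v = ε v u) (hAA : ∀ u v, u ≠ v → α u = 1 → α v = 1 → ε u v = 0) :
    Col n α (rhoOf α ε) (betaOf α ε) where
  hα := hα
  hρ := by
    intro u v
    unfold rhoOf
    split_ifs
    · simp
    · rcases hα u with a | a <;> rcases hα v with b | b <;> rcases hε u v with c | c <;>
        simp [a, b, c]
  hρs := by
    intro u v
    unfold rhoOf
    rw [hs u v]
    by_cases h : u = v
    · simp [h]
    · rw [if_neg h, if_neg (Ne.symm h)]; ring
  hd := by intro u; simp [rhoOf]
  hβ := by intro u v; rfl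
  hAA := by
    intro u v huv a b
    have := hAA u v huv a b
    simp [rhoOf, huv, a, b, this]

lemma psi_d3 {ρ β : Fin n → Fin n → ℝ} (h : Col n α ρ β) (u v w : Fin n) :
    d3 u v w * psi α ρ β u v w = psi α ρ β u v w := by
  unfold d3
  split_ifs with hd
  · ring
  · rw [zero_mul]
    symm
    have hk : ∀ u, (1 - α u) * α u = 0 := by
      intro u; rcases h.hα u with a | a <;> simp [a]
    have hrb := h.rb0
    by_cases h1 : u = v
    · subst h1
      unfold psi
      simp only [h.hd, h.bd]
      have := hk u
      split_ifs
      · ring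
      · linear_combination (- α w) * this
    by_cases h2 : u = w
    · subst h2
      unfold psi
      simp only [h.hd, h.bd]
      have := hk u
      split_ifs
      · ring
      · linear_combination (- α v) * this
    have h3 : v = w := by
      by_contra h3
      exact hd ⟨h1, h2, h3⟩
    subst h3
    unfold psi
    have := hrb u v
    simp only [h.bd, if_true]
    linear_combination (1 - 2 * α u * (1 - α v) * (1 - α v)) * this

lemma psi_sum {ρ β : Fin n → Fin n → ℝ} (h : Col n α ρ β) :
    ∑ u, ∑ v, ∑ w, psi α ρ β u v w = ∑ u, (∑ v, ρ u v) * (∑ v, β u v) - 2 * bigP α ρ β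
      - ∑ u, (1 - α u) * sg α β u - 2 * ∑ u, α u * (rB α ρ u * bB α β u) := by
  have hP : bigP α ρ β = ∑ u, ∑ v, ∑ w,
      (1 - α u) * (1 - α v) * (1 - α w) * (ρ u v * ρ u w * β v w) := by
    unfold bigP
    rw [sw13, sw23, sw13, sw12, sw13]
    refine sum_congr rfl fun u _ => sum_congr rfl fun v _ => sum_congr rfl fun w _ => ?_
    rw [h.hρs u v, h.hρs u w, h.bs v w]
    ring
  have hin : ∀ u, ∑ v, ∑ w, psi α ρ β u v w = (∑ v, ρ u v) * (∑ v, β u v)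
      - 2 * ∑ v, ∑ w, (1 - α u) * (1 - α v) * (1 - α w) * (ρ u v * ρ u w * β v w)
      - (1 - α u) * sg α β u - 2 * (α u * (rB α ρ u * bB α β u)) := by
    intro u
    have e1 : ∑ v, ∑ w, (ρ u v * β u w + β u v * ρ u w) / 2 = (∑ v, ρ u v) * (∑ v, β u v) := by
      have c1 : ∑ v, ∑ w, ρ u v * β u w = (∑ v, ρ u v) * (∑ v, β u v) := by
        rw [sum_mul_sum]
      have c2 : ∑ v, ∑ w, β u v * ρ u w = (∑ v, ρ u v) * (∑ v, β u v) := by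
        rw [mul_comm, sum_mul_sum]
      simp only [← sum_div, sum_add_distrib]
      rw [c1, c2]; ring
    have e2 : ∑ v, ∑ w, α u * (1 - α v) * (1 - α w) * (ρ u v * β u w + β u v * ρ u w)
        = 2 * (α u * (rB α ρ u * bB α β u)) := by
      have c1 : ∑ v, ∑ w, ((1 - α v) * ρ u v) * ((1 - α w) * β u w) = rB α ρ u * bB α β u := by
        unfold rB bB
        rw [sum_mul_sum]
      have c2 : ∑ v, ∑ w, ((1 - α v) * β u v) * ((1 - α w) * ρ u w) = rB α ρ u * bB α β u := by
        unfold rB bB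
        rw [mul_comm, sum_mul_sum]
      have : ∀ v w, α u * (1 - α v) * (1 - α w) * (ρ u v * β u w + β u v * ρ u w) =
        α u * (((1 - α v) * ρ u v) * ((1 - α w) * β u w)) +
        α u * (((1 - α v) * β u v) * ((1 - α w) * ρ u w)) := by intro v w; ring
      simp only [this, sum_add_distrib, ← mul_sum]
      simp only [mul_sum] at c1 c2 ⊢
      simp only [← mul_sum] at c1 c2 ⊢
      rw [c1, c2]; ring
    unfold psi sg
    simp only [sum_sub_distrib]
    rw [e1, e2]
    simp only [mul_sum]
  simp only [hin, sum_sub_distrib, ← mul_sum]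
  rw [hP]

lemma bigQ_eq (hα : ∀ u, α u = 0 ∨ α u = 1) : bigQ α (nonE ε) = bigQ α (betaOf α ε) := by
  have hb : ∀ u v, α u = 0 → α v = 0 → betaOf α ε u v = nonE ε u v := by
    intro u v a b
    unfold betaOf nonE rhoOf
    split_ifs
    · rfl
    · rw [a, b]; ring
  unfold bigQ tri
  refine sum_congr rfl fun u _ => sum_congr rfl fun v _ => sum_congr rfl fun w _ =>
    sum_congr rfl fun x _ => ?_
  rcases hα u with a | a
  · rcases hα v with b | b
    · rcases hα w with c | c
      · rcases hα x with d | d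
        · rw [hb u v a b, hb u w a c, hb v w b c, hb u x a d, hb v x b d, hb w x c d]
        · rw [d]; ring
      · rw [c]; ring
    · rw [b]; ring
  · rw [a]; ring

lemma partTwo (hn : 4 ≤ n) (hn2 : n ≤ 12) (hα : ∀ u, α u = 0 ∨ α u = 1)
    (hε : ∀ u v, ε u v = 0 ∨ ε u v = 1)
    (hs : ∀ u v, ε u v = ε v u) (hAA : ∀ u v, u ≠ v → α u = 1 → α v = 1 → ε u v = 0) :
    (∑ u, ∑ v, ∑ w, d3 u v w * (triU α ε u v w
      + 3 * (if triU α ε u v w ≤ 1 then (1 : ℝ) else 0) - 3)) / 3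
      + bigQ α (nonE ε) / (4 * (n - 3)) ≤
      (((n + 1) / 2 : ℕ) : ℝ) * ((n / 2 : ℕ) : ℝ) * (n - 2) := by
  have h := colOf hα hε hs hAA
  have c := core h hn hn2
  rw [bigQ_eq hα]
  rw [← psi_sum h] at c
  set ρ := rhoOf α ε with hρ
  set β := betaOf α ε with hβ
  have key : ∑ u, ∑ v, ∑ w, d3 u v w * (triU α ε u v w
      + 3 * (if triU α ε u v w ≤ 1 then (1 : ℝ) else 0) - 3) ≤
      ∑ u, ∑ v, ∑ w, (psi α ρ β u v w + psi α ρ β v u w + psi α ρ β w v u) := by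
    refine sum_le_sum fun u _ => sum_le_sum fun v _ => sum_le_sum fun w _ => ?_
    by_cases hd : u ≠ v ∧ u ≠ w ∧ v ≠ w
    · have p := pointwise (α u) (α v) (α w) (ε u v) (ε u w) (ε v w) (hα _) (hα _) (hα _)
        (hε _ _) (hε _ _) (hε _ _) (hAA _ _ hd.1) (hAA _ _ hd.2.1) (hAA _ _ hd.2.2)
        (ρ u v) (ρ u w) (ρ v w) (by simp [hρ, rhoOf, hd.1]) (by simp [hρ, rhoOf, hd.2.1])
        (by simp [hρ, rhoOf, hd.2.2])
      have q : d3 u v w = 1 := by unfold d3; rw [if_pos hd]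
      rw [q, one_mul]
      unfold triU psi
      rw [if_neg hd.2.2, if_neg hd.2.1, if_neg (Ne.symm hd.1)]
      rw [h.hρs v u, h.hρs w u, h.hρs w v, h.bs v u, h.bs w u, h.bs w v,
        h.rb u v hd.1, h.rb u w hd.2.1, h.rb v w hd.2.2]
      refine p.trans (le_of_eq ?_)
      ring
    · have q : d3 u v w = 0 := by unfold d3; rw [if_neg hd]
      have q2 : d3 v u w = 0 := by unfold d3; rw [if_neg]; tauto
      have q3 : d3 w v u = 0 := by
        unfold d3; rw [if_neg]; rintro ⟨x, y, z⟩; exact hd ⟨z.symm, y.symm, x.symm⟩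
      rw [← psi_d3 h u v w, ← psi_d3 h v u w, ← psi_d3 h w v u, q, q2, q3]
      simp
  simp only [sum_add_distrib] at key
  have s1 := sw12 (psi α ρ β)
  have s2 := sw13 (psi α ρ β)
  linarith

end partTwo

section counting
variable {n : ℕ}

noncomputable def chi (C : Finset (Fin n)) (u : Fin n) : ℝ := if u ∈ C then 1 else 0
noncomputable def ne2 (u v : Fin n) : ℝ := if u = v then 0 else 1

lemma d3_eq (u v w : Fin n) : d3 u v w = ne2 u v * (ne2 u w * ne2 v w) := by
  unfold d3 ne2
  by_cases h1 : u = v <;> by_cases h2 : u = w <;> by_cases h3 : v = w <;> simp [h1, h2, h3]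

noncomputable def d4 (u v w x : Fin n) : ℝ := d3 u v w * (ne2 u x * ne2 v x * ne2 w x)

lemma chi_sum (C : Finset (Fin n)) : ∑ u, chi C u = C.card := by
  unfold chi; simp

lemma cnt2a (C : Finset (Fin n)) (u : Fin n) :
    chi C u * ∑ v, ne2 u v * chi C v = chi C u * (C.card - 1) := by
  have e : ∀ v, ne2 u v * chi C v = chi C v - (if u = v then chi C v else 0) := by
    intro v; unfold ne2; split_ifs <;> ring
  simp only [e, sum_sub_distrib, chi_sum, sum_ite_eq, mem_univ, if_true]
  unfold chi; split_ifs <;> ring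

lemma cnt3a (C : Finset (Fin n)) (u v : Fin n) :
    ne2 u v * chi C u * chi C v * ∑ w, ne2 u w * ne2 v w * chi C w
      = ne2 u v * chi C u * chi C v * (C.card - 2) := by
  by_cases huv : u = v
  · simp [ne2, huv]
  have e : ∀ w, ne2 u w * ne2 v w * chi C w = chi C w - (if u = w then chi C w else 0)
      - (if v = w then chi C w else 0) := by
    intro w; unfold ne2
    by_cases h1 : u = w
    · subst h1; simp [Ne.symm huv]
    · by_cases h2 : v = w <;> simp [h1, h2]
  simp only [e, sum_sub_distrib, chi_sum, sum_ite_eq, mem_univ, if_true]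
  unfold chi; split_ifs <;> ring

lemma cnt4a (C : Finset (Fin n)) (u v w : Fin n) :
    d3 u v w * chi C u * chi C v * chi C w * ∑ x, ne2 u x * ne2 v x * ne2 w x * chi C x
      = d3 u v w * chi C u * chi C v * chi C w * (C.card - 3) := by
  by_cases hd : u ≠ v ∧ u ≠ w ∧ v ≠ w
  swap
  · simp [d3, hd]
  obtain ⟨h1, h2, h3⟩ := hd
  have e : ∀ x, ne2 u x * ne2 v x * ne2 w x * chi C x = chi C x - (if u = x then chi C x else 0)
      - (if v = x then chi C x else 0) - (if w = x then chi C x else 0) := by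
    intro x; unfold ne2
    by_cases g1 : u = x
    · subst g1; simp [h1.symm, h2.symm]
    · by_cases g2 : v = x
      · subst g2; simp [h1, h3.symm]
      · by_cases g3 : w = x <;> simp [g1, g2, g3]
  simp only [e, sum_sub_distrib, chi_sum, sum_ite_eq, mem_univ, if_true]
  unfold chi; split_ifs <;> ring

lemma cnt2 (C : Finset (Fin n)) :
    ∑ u, ∑ v, ne2 u v * (chi C u * chi C v) = C.card * (C.card - 1) := by
  have : ∀ u, ∑ v, ne2 u v * (chi C u * chi C v) = chi C u * (C.card - 1) := by
    intro u
    rw [← cnt2a, mul_sum]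
    exact sum_congr rfl fun v _ => by ring
  simp only [this, ← sum_mul, chi_sum]

lemma cnt3 (C : Finset (Fin n)) :
    ∑ u, ∑ v, ∑ w, d3 u v w * (chi C u * chi C v * chi C w)
      = C.card * (C.card - 1) * (C.card - 2) := by
  have : ∀ u v, ∑ w, d3 u v w * (chi C u * chi C v * chi C w)
      = ne2 u v * (chi C u * chi C v) * (C.card - 2) := by
    intro u v
    have := cnt3a C u v
    rw [mul_sum] at this
    rw [show ne2 u v * (chi C u * chi C v) * ((C.card : ℝ) - 2)
      = ne2 u v * chi C u * chi C v * (C.card - 2) by ring, ← this]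
    exact sum_congr rfl fun w _ => by rw [d3_eq]; ring
  simp only [this, ← sum_mul, cnt2]

lemma cnt4 (C : Finset (Fin n)) :
    ∑ u, ∑ v, ∑ w, ∑ x, d4 u v w x * (chi C u * chi C v * chi C w * chi C x)
      = C.card * (C.card - 1) * (C.card - 2) * (C.card - 3) := by
  have : ∀ u v w, ∑ x, d4 u v w x * (chi C u * chi C v * chi C w * chi C x)
      = d3 u v w * (chi C u * chi C v * chi C w) * (C.card - 3) := by
    intro u v w
    have := cnt4a C u v w
    rw [mul_sum] at this
    rw [show d3 u v w * (chi C u * chi C v * chi C w) * ((C.card : ℝ) - 3)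
      = d3 u v w * chi C u * chi C v * chi C w * (C.card - 3) by ring, ← this]
    exact sum_congr rfl fun w _ => by unfold d4; ring
  simp only [this, ← sum_mul, cnt3]

lemma chi_univ (u : Fin n) : chi univ u = 1 := by simp [chi]

lemma d3_sum_w (u v : Fin n) : ∑ w, d3 u v w = ne2 u v * ((n : ℝ) - 2) := by
  have := cnt3a univ u v
  simp only [chi_univ, mul_one, card_univ, Fintype.card_fin, mul_sum] at this
  rw [← this]
  exact sum_congr rfl fun w _ => d3_eq u v w

lemma ne2_sum (u : Fin n) : ∑ v, ne2 u v = (n : ℝ) - 1 := by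
  have := cnt2a univ u
  simpa only [chi_univ, mul_one, one_mul, card_univ, Fintype.card_fin] using this

lemma d3_sw12 (u v w : Fin n) : d3 u v w = d3 v u w := by
  unfold d3; congr 1; apply propext; constructor <;> rintro ⟨a, b, c⟩ <;> exact ⟨a.symm, c, b⟩
lemma d3_sw13 (u v w : Fin n) : d3 u v w = d3 w v u := by
  unfold d3; congr 1; apply propext
  constructor <;> rintro ⟨a, b, c⟩ <;> exact ⟨c.symm, b.symm, a.symm⟩

lemma d3_sum_uv (f : Fin n → Fin n → ℝ) : ∑ u, ∑ v, ∑ w, d3 u v w * f u v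
    = (∑ u, ∑ v, ne2 u v * f u v) * ((n : ℝ) - 2) := by
  simp only [← sum_mul, d3_sum_w]
  simp only [sum_mul]
  exact sum_congr rfl fun u _ => sum_congr rfl fun v _ => by ring

lemma d3_sum_u (f : Fin n → ℝ) : ∑ u, ∑ v, ∑ w, d3 u v w * f u
    = (∑ u, f u) * ((n : ℝ) - 1) * ((n : ℝ) - 2) := by
  rw [d3_sum_uv (fun u _ => f u)]
  simp only [← sum_mul, ne2_sum]
  simp only [sum_mul]
  exact sum_congr rfl fun u _ => by ring

lemma d3_sum_triU (α : Fin n → ℝ) (ε : Fin n → Fin n → ℝ) :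
    ∑ u, ∑ v, ∑ w, d3 u v w * triU α ε u v w = 3 * ((∑ u, α u) * ((n : ℝ) - 1) * ((n : ℝ) - 2))
      + 3 * ((∑ u, ∑ v, ne2 u v * ε u v) * ((n : ℝ) - 2)) := by
  have e : ∀ u v w, d3 u v w * triU α ε u v w = d3 u v w * α u + d3 u v w * α v + d3 u v w * α w
      + d3 u v w * ε u v + d3 u v w * ε u w + d3 u v w * ε v w := by
    intro u v w; unfold triU; ring
  simp only [e, sum_add_distrib]
  have a1 := d3_sum_u α
  have a2 : ∑ u, ∑ v, ∑ w, d3 u v w * α v = ∑ u, ∑ v, ∑ w, d3 u v w * α u := by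
    rw [sw12]
    exact sum_congr rfl fun u _ => sum_congr rfl fun v _ => sum_congr rfl fun w _ => by
      rw [d3_sw12]
  have a3 : ∑ u, ∑ v, ∑ w, d3 u v w * α w = ∑ u, ∑ v, ∑ w, d3 u v w * α u := by
    rw [sw13]
    exact sum_congr rfl fun u _ => sum_congr rfl fun v _ => sum_congr rfl fun w _ => by
      rw [d3_sw13]
  have b1 := d3_sum_uv ε
  have b2 : ∑ u, ∑ v, ∑ w, d3 u v w * ε u w = ∑ u, ∑ v, ∑ w, d3 u v w * ε u v := by
    rw [sw23]
    exact sum_congr rfl fun u _ => sum_congr rfl fun v _ => sum_congr rfl fun w _ => by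
      rw [d3_sw12 u w v, d3_sw13 w u v, d3_sw12]
  have b3 : ∑ u, ∑ v, ∑ w, d3 u v w * ε v w = ∑ u, ∑ v, ∑ w, d3 u v w * ε u v := by
    rw [sw12, sw23]
    exact sum_congr rfl fun u _ => sum_congr rfl fun v _ => sum_congr rfl fun w _ => by
      rw [d3_sw12 w u v, d3_sw12 u w v, d3_sw13 w u v, d3_sw12]
  rw [a2, a3, b2, b3, a1, b1]
  ring

lemma d3_sum_one : ∑ u : Fin n, ∑ v : Fin n, ∑ w : Fin n, d3 u v w
    = (n : ℝ) * ((n : ℝ) - 1) * ((n : ℝ) - 2) := by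
  have := cnt3 (univ : Finset (Fin n))
  simpa only [chi_univ, mul_one, card_univ, Fintype.card_fin] using this

lemma choose3 (N c : ℕ) (hc : 3 ≤ c) (hcN : c ≤ N) :
    (c : ℝ) * (c - 1) * (c - 2) * (1 / ((N - 3).choose (c - 3) : ℝ))
      = (N : ℝ) * (N - 1) * (N - 2) * (1 / (N.choose c : ℝ)) := by
  obtain ⟨j, rfl⟩ : ∃ j, c = j + 3 := ⟨c - 3, by omega⟩
  obtain ⟨m, rfl⟩ : ∃ m, N = m + 3 := ⟨N - 3, by omega⟩
  have hjm : j ≤ m := by omega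
  simp only [Nat.add_sub_cancel]
  have p1 : (0 : ℝ) < (m.choose j : ℝ) := by exact_mod_cast Nat.choose_pos hjm
  have p2 : (0 : ℝ) < ((m + 3).choose (j + 3) : ℝ) := by exact_mod_cast Nat.choose_pos hcN
  have e1 : ((m : ℝ) + 1) * m.choose j = (m + 1).choose (j + 1) * (j + 1) := by
    exact_mod_cast Nat.add_one_mul_choose_eq m j
  have e2 : ((m : ℝ) + 1 + 1) * (m + 1).choose (j + 1) = (m + 2).choose (j + 2) * (j + 1 + 1) := by
    exact_mod_cast Nat.add_one_mul_choose_eq (m + 1) (j + 1)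
  have e3 : ((m : ℝ) + 2 + 1) * (m + 2).choose (j + 2) = (m + 3).choose (j + 3) * (j + 2 + 1) := by
    exact_mod_cast Nat.add_one_mul_choose_eq (m + 2) (j + 2)
  rw [mul_one_div, mul_one_div, div_eq_div_iff p1.ne' p2.ne']
  push_cast
  linear_combination (-(j + 1 : ℝ) * (j + 2)) * e3 - ((j + 1 : ℝ) * (m + 3)) * e2
    - ((m + 2 : ℝ) * (m + 3)) * e1

lemma choose4 (N c : ℕ) (hc : 4 ≤ c) (hcN : c ≤ N) :
    (c : ℝ) * (c - 1) * (c - 2) * (c - 3) * (1 / ((N - 4).choose (c - 4) : ℝ))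
      = (N : ℝ) * (N - 1) * (N - 2) * (N - 3) * (1 / (N.choose c : ℝ)) := by
  have h3 := choose3 N c (by omega) hcN
  obtain ⟨j, rfl⟩ : ∃ j, c = j + 4 := ⟨c - 4, by omega⟩
  obtain ⟨m, rfl⟩ : ∃ m, N = m + 4 := ⟨N - 4, by omega⟩
  have hjm : j ≤ m := by omega
  have e4 : ((m : ℝ) + 1) * m.choose j = (m + 1).choose (j + 1) * (j + 1) := by
    exact_mod_cast Nat.add_one_mul_choose_eq m j
  have p1 : (0 : ℝ) < (m.choose j : ℝ) := by exact_mod_cast Nat.choose_pos hjm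
  have p2 : (0 : ℝ) < ((m + 1).choose (j + 1) : ℝ) := by
    exact_mod_cast Nat.choose_pos (by omega : j + 1 ≤ m + 1)
  have i1 : j + 4 - 3 = j + 1 := by omega
  have i2 : m + 4 - 3 = m + 1 := by omega
  rw [i1, i2] at h3
  simp only [Nat.add_sub_cancel]
  push_cast at h3 ⊢
  have e5 : ((j : ℝ) + 4 - 3) * (1 / (m.choose j : ℝ))
      = (m + 4 - 3) * (1 / ((m + 1).choose (j + 1) : ℝ)) := by
    rw [mul_one_div, mul_one_div, div_eq_div_iff p1.ne' p2.ne']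
    linarith
  calc _ = ((j : ℝ) + 4) * (j + 4 - 1) * (j + 4 - 2) * ((j + 4 - 3) * (1 / (m.choose j : ℝ))) := by
        ring
    _ = (((j : ℝ) + 4) * (j + 4 - 1) * (j + 4 - 2) * (1 / ((m + 1).choose (j + 1) : ℝ)))
        * (m + 4 - 3) := by rw [e5]; ring
    _ = _ := by rw [h3]; ring

lemma choose_ge4 : ∀ c s : Fin 13, 3 ≤ s.val → s.val < c.val → 4 ≤ c.val.choose s.val := by
  decide +kernel

end counting

section family
variable {n : ℕ} {F : Finset (Finset (Fin n))}

lemma lamF (hF : DkFree n 2 F) (h0 : ∅ ∈ F) {C S S' : Finset (Fin n)} (hC : C ∈ F)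
    (hS : S ∈ F) (hS' : S' ∈ F) (n1 : S.Nonempty) (n2 : S'.Nonempty) (s1 : S ⊂ C) (s2 : S' ⊂ C) :
    S = S' := by
  by_contra hne
  apply hF
  refine ⟨∅, C, ![S, S'], h0, hC, ?_, ?_, ?_, ?_, ?_⟩
  · intro i; fin_cases i <;> simp [hS, hS']
  · intro i j hij
    fin_cases i <;> fin_cases j <;> simp_all
  · intro i
    fin_cases i
    · exact ⟨n1.ne_empty, s1.ne⟩
    · exact ⟨n2.ne_empty, s2.ne⟩
  · rintro rfl
    exact absurd s1.1 (by simpa using n1.ne_empty)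
  · intro i
    fin_cases i
    · exact ⟨empty_subset _, s1.1⟩
    · exact ⟨empty_subset _, s2.1⟩

noncomputable def alF (F : Finset (Finset (Fin n))) (u : Fin n) : ℝ := if {u} ∈ F then 1 else 0
noncomputable def epF (F : Finset (Finset (Fin n))) (u v : Fin n) : ℝ :=
  if u ≠ v ∧ {u, v} ∈ F then 1 else 0
def big3 (F : Finset (Finset (Fin n))) : Finset (Finset (Fin n)) := F.filter (fun C => 3 ≤ C.card)
def big4 (F : Finset (Finset (Fin n))) : Finset (Finset (Fin n)) :=
  (big3 F).filter (fun C => ∃ S ∈ big3 F, S ⊂ C)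

lemma mem_big3 {C : Finset (Fin n)} : C ∈ big3 F ↔ C ∈ F ∧ 3 ≤ C.card := by simp [big3]
lemma mem_big4 {C : Finset (Fin n)} : C ∈ big4 F ↔ C ∈ big3 F ∧ ∃ S ∈ big3 F, S ⊂ C := by
  simp [big4]
lemma ne_big3 {C : Finset (Fin n)} (h : C ∈ big3 F) : C.Nonempty := by
  rw [← card_pos]; have := (mem_big3.mp h).2; omega

lemma chi3_eq (C : Finset (Fin n)) (u v w : Fin n) :
    chi C u * chi C v * chi C w = if ({u, v, w} : Finset (Fin n)) ⊆ C then 1 else 0 := by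
  unfold chi
  by_cases h1 : u ∈ C <;> by_cases h2 : v ∈ C <;> by_cases h3 : w ∈ C <;>
    simp [h1, h2, h3, insert_subset_iff]
lemma chi4_eq (C : Finset (Fin n)) (u v w x : Fin n) :
    chi C u * chi C v * chi C w * chi C x
      = if ({u, v, w, x} : Finset (Fin n)) ⊆ C then 1 else 0 := by
  unfold chi
  by_cases h1 : u ∈ C <;> by_cases h2 : v ∈ C <;> by_cases h3 : w ∈ C <;> by_cases h4 : x ∈ C <;>
    simp [h1, h2, h3, h4, insert_subset_iff]

/-- a large member contains no small member besides its unique one -/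
lemma no_two (hF : DkFree n 2 F) (h0 : ∅ ∈ F) {C : Finset (Fin n)} (hC : C ∈ big3 F)
    {A B : Finset (Fin n)} (hA : A ∈ F) (hB : B ∈ F) (a1 : A.Nonempty) (b1 : B.Nonempty)
    (a2 : A.card ≤ 2) (b2 : B.card ≤ 2) (hAC : A ⊆ C) (hBC : B ⊆ C) : A = B := by
  obtain ⟨c1, c2⟩ := mem_big3.mp hC
  refine lamF hF h0 c1 hA hB a1 b1 (hAC.ssubset_of_ne ?_) (hBC.ssubset_of_ne ?_)
  · rintro rfl; omega
  · rintro rfl; omega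

lemma triU_le (hF : DkFree n 2 F) (h0 : ∅ ∈ F) {C : Finset (Fin n)} (hC : C ∈ big3 F)
    {u v w : Fin n} (h1 : u ≠ v) (h2 : u ≠ w) (h3 : v ≠ w) (hu : u ∈ C) (hv : v ∈ C) (hw : w ∈ C) :
    triU (alF F) (epF F) u v w ≤ 1 := by
  have key : ∀ A B : Finset (Fin n), A ≠ B → A.Nonempty → B.Nonempty → A.card ≤ 2 → B.card ≤ 2 →
      A ⊆ C → B ⊆ C → A ∈ F → B ∈ F → False := by
    intro A B hne a1 b1 a2 b2 a3 b3 hA hB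
    exact hne (no_two hF h0 hC hA hB a1 b1 a2 b2 a3 b3)
  have card2 : ∀ a b : Fin n, ({a, b} : Finset (Fin n)).card ≤ 2 := fun a b => card_le_two
  have s1 : ∀ a b : Fin n, a ∈ C → b ∈ C → a ≠ b → {a} ∈ F → {b} ∈ F → False := by
    intro a b ha hb hab
    exact key {a} {b} (by simpa using hab) (by simp) (by simp) (by simp) (by simp) (by simpa)
      (by simpa)
  have s2 : ∀ a b c : Fin n, a ∈ C → b ∈ C → c ∈ C → b ≠ c → {a} ∈ F → {b, c} ∈ F → False := by
    intro a b c ha hb hc hbc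
    refine key {a} {b, c} ?_ (by simp) (by simp) (by simp) (card2 _ _) (by simpa)
      (by simp [insert_subset_iff, hb, hc])
    intro h
    have := congrArg card h
    rw [card_pair hbc] at this
    simp at this
  have s3 : ∀ a b c : Fin n, a ∈ C → b ∈ C → c ∈ C → b ≠ c → b ≠ a → {a, b} ∈ F → {a, c} ∈ F →
      False := by
    intro a b c ha hb hc hbc hba
    refine key {a, b} {a, c} ?_ (by simp) (by simp) (card2 _ _) (card2 _ _)
      (by simp [insert_subset_iff, hb, ha]) (by simp [insert_subset_iff, ha, hc])
    intro h
    have : b ∈ ({a, c} : Finset (Fin n)) := by rw [← h]; simp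
    simp [hba, hbc] at this
  have a1 := s1 u v hu hv h1
  have a2 := s1 u w hu hw h2
  have a3 := s1 v w hv hw h3
  have b1 := s2 u u v hu hu hv h1
  have b2 := s2 u u w hu hu hw h2
  have b3 := s2 u v w hu hv hw h3
  have b4 := s2 v u v hv hu hv h1
  have b5 := s2 v u w hv hu hw h2
  have b6 := s2 v v w hv hv hw h3
  have b7 := s2 w u v hw hu hv h1
  have b8 := s2 w u w hw hu hw h2
  have b9 := s2 w v w hw hv hw h3
  have c1 := s3 u v w hu hv hw h3 h1.symm
  have c2 : {u, v} ∈ F → {v, w} ∈ F → False := by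
    rw [pair_comm u v]; exact s3 v u w hv hu hw h2 h1
  have c3 : {u, w} ∈ F → {v, w} ∈ F → False := by
    rw [pair_comm u w, pair_comm v w]; exact s3 w u v hw hu hv h1 h2
  unfold triU alF epF
  by_cases x1 : {u} ∈ F
  · have y1 : {v} ∉ F := fun h => a1 x1 h
    have y2 : {w} ∉ F := fun h => a2 x1 h
    have y3 : {u, v} ∉ F := fun h => b1 x1 h
    have y4 : {u, w} ∉ F := fun h => b2 x1 h
    have y5 : {v, w} ∉ F := fun h => b3 x1 h
    simp [x1, y1, y2, y3, y4, y5]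
  by_cases x2 : {v} ∈ F
  · have y2 : {w} ∉ F := fun h => a3 x2 h
    have y3 : {u, v} ∉ F := fun h => b4 x2 h
    have y4 : {u, w} ∉ F := fun h => b5 x2 h
    have y5 : {v, w} ∉ F := fun h => b6 x2 h
    simp [x1, x2, y2, y3, y4, y5]
  by_cases x3 : {w} ∈ F
  · have y3 : {u, v} ∉ F := fun h => b7 x3 h
    have y4 : {u, w} ∉ F := fun h => b8 x3 h
    have y5 : {v, w} ∉ F := fun h => b9 x3 h
    simp [x1, x2, x3, y3, y4, y5]
  by_cases x4 : {u, v} ∈ F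
  · have y4 : {u, w} ∉ F := fun h => c1 x4 h
    have y5 : {v, w} ∉ F := fun h => c2 x4 h
    simp [x1, x2, x3, x4, y4, y5, h1]
  by_cases x5 : {u, w} ∈ F
  · have y5 : {v, w} ∉ F := fun h => c3 x5 h
    simp [x1, x2, x3, x4, x5, y5, h2]
  simp only [x1, x2, x3, x4, x5, if_false, and_false]
  split_ifs <;> norm_num

lemma triple_bound (hF : DkFree n 2 F) (h0 : ∅ ∈ F) (u v w : Fin n) :
    d3 u v w * ∑ C ∈ big3 F, chi C u * chi C v * chi C w * (1 / ((n - 3).choose (C.card - 3) : ℝ))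
    ≤ d3 u v w * ((if triU (alF F) (epF F) u v w ≤ 1 then (1 : ℝ) else 0)
      + ∑ C ∈ big3 F, ∑ S ∈ (big3 F).filter (fun S => S ⊂ C), chi S u * chi S v * chi S w *
        (1 / ((n - 3).choose (C.card - 3) : ℝ) * (1 / ((C.card - 3).choose (S.card - 3) : ℝ)))) := by
  by_cases hd : u ≠ v ∧ u ≠ w ∧ v ≠ w
  swap
  · simp [d3, hd]
  have q : d3 u v w = 1 := by unfold d3; rw [if_pos hd]
  rw [q, one_mul, one_mul]
  obtain ⟨h1, h2, h3⟩ := hd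
  simp only [chi3_eq]
  set t : Finset (Fin n) := {u, v, w} with ht
  have htc : t.card = 3 := card_eq_three.mpr ⟨u, v, w, h1, h2, h3, rfl⟩
  have b := bonf t (n - 3) univ (subset_univ _) (by simp [htc])
    ((big3 F).filter (fun C => t ⊆ C)) (by
      intro X hX; exact ⟨(mem_filter.mp hX).2, subset_univ _⟩)
  by_cases hE : ∃ C ∈ big3 F, t ⊆ C
  · obtain ⟨C, hC, htC⟩ := hE
    have hU := triU_le hF h0 hC h1 h2 h3 (htC (by simp [ht])) (htC (by simp [ht]))
      (htC (by simp [ht]))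
    rw [if_pos hU]
    have l : ∑ C ∈ big3 F, (if t ⊆ C then (1 : ℝ) else 0) * (1 / ((n - 3).choose (C.card - 3) : ℝ))
        = ∑ X ∈ (big3 F).filter (fun C => t ⊆ C), iw univ t X := by
      rw [sum_filter]
      refine sum_congr rfl fun X _ => ?_
      unfold iw
      rw [htc, card_univ, Fintype.card_fin]
      split_ifs <;> ring
    rw [l]
    refine b.trans (add_le_add_right (le_of_eq ?_) 1)
    rw [sum_filter]
    refine sum_congr rfl fun X _ => ?_
    rw [filter_filter]
    simp only [sum_filter]
    split_ifs with hX
    · refine sum_congr rfl fun S _ => ?_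
      unfold iw
      rw [htc, card_univ, Fintype.card_fin]
      by_cases g1 : t ⊆ S <;> by_cases g2 : S ⊂ X <;> simp [g1, g2]
    · symm
      apply sum_eq_zero
      intro S _
      by_cases g2 : S ⊂ X
      · have g1 : ¬ t ⊆ S := fun h => hX (h.trans g2.1)
        simp [g1]
      · simp [g2]
  · push Not at hE
    have l : ∑ C ∈ big3 F, (if t ⊆ C then (1 : ℝ) else 0) * (1 / ((n - 3).choose (C.card - 3) : ℝ))
        = 0 := by
      apply sum_eq_zero
      intro C hC
      simp [hE C hC]
    rw [l]
    refine add_nonneg (by split_ifs <;> norm_num) (sum_nonneg fun C _ => sum_nonneg fun S _ => ?_)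
    split_ifs <;> positivity

lemma quad_bound (hF : DkFree n 2 F) (h0 : ∅ ∈ F) (u v w x : Fin n) :
    d4 u v w x * ∑ C ∈ big4 F, chi C u * chi C v * chi C w * chi C x *
      (1 / ((n - 4).choose (C.card - 4) : ℝ))
    ≤ tri (alF F) (nonE (epF F)) u v w * ((1 - alF F x) * nonE (epF F) u x * nonE (epF F) v x
      * nonE (epF F) w x) := by
  have k0 : ∀ a, 0 ≤ 1 - alF F a := by intro a; unfold alF; split_ifs <;> norm_num
  have e0 : ∀ a b, 0 ≤ nonE (epF F) a b := by
    intro a b; unfold nonE epF; split_ifs <;> norm_num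
  have r0 : 0 ≤ tri (alF F) (nonE (epF F)) u v w * ((1 - alF F x) * nonE (epF F) u x *
      nonE (epF F) v x * nonE (epF F) w x) := by
    unfold tri
    have := k0 u; have := k0 v; have := k0 w; have := k0 x
    have := e0 u v; have := e0 u w; have := e0 v w
    have := e0 u x; have := e0 v x; have := e0 w x
    positivity
  by_cases hd : (u ≠ v ∧ u ≠ w ∧ v ≠ w) ∧ (u ≠ x ∧ v ≠ x ∧ w ≠ x)
  swap
  · have q : d4 u v w x = 0 := by
      unfold d4 d3 ne2
      by_contra hcon
      apply hd
      constructor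
      · by_contra h; simp [h] at hcon
      · refine ⟨?_, ?_, ?_⟩ <;> (intro h; simp [h] at hcon)
    rw [q, zero_mul]; exact r0
  obtain ⟨⟨h1, h2, h3⟩, h4, h5, h6⟩ := hd
  have q : d4 u v w x = 1 := by simp [d4, d3, ne2, h1, h2, h3, h4, h5, h6]
  rw [q, one_mul]
  simp only [chi4_eq]
  set t : Finset (Fin n) := {u, v, w, x} with ht
  have htc : t.card = 4 := by
    rw [ht, card_insert_of_notMem (by simp [h1, h2, h4]), card_insert_of_notMem (by simp [h3, h5]),
      card_pair h6]
  have b := bonf t (n - 4) univ (subset_univ _) (by simp [htc])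
    ((big4 F).filter (fun C => t ⊆ C)) (by
      intro X hX; exact ⟨(mem_filter.mp hX).2, subset_univ _⟩)
  have anti : ∀ C ∈ big4 F, ∀ S ∈ big4 F, ¬ S ⊂ C := by
    intro C hC S hS hSC
    obtain ⟨c1, _⟩ := mem_big4.mp hC
    obtain ⟨s1, S', hS', hSS⟩ := mem_big4.mp hS
    have := lamF hF h0 (mem_big3.mp c1).1 (mem_big3.mp s1).1 (mem_big3.mp hS').1
      (ne_big3 s1) (ne_big3 hS') hSC (hSS.trans hSC)
    exact hSS.ne this.symm
  have z : ∑ C ∈ (big4 F).filter (fun C => t ⊆ C), ∑ S ∈ ((big4 F).filter (fun C => t ⊆ C)).filter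
      (fun S => S ⊂ C), iw univ t C * iw C t S = 0 := by
    apply sum_eq_zero
    intro C hC
    apply sum_eq_zero
    intro S hS
    rw [mem_filter, mem_filter] at hS
    exact absurd hS.2 (anti C (mem_filter.mp hC).1 S hS.1.1)
  rw [z, add_zero] at b
  have l : ∑ C ∈ big4 F, (if t ⊆ C then (1 : ℝ) else 0) * (1 / ((n - 4).choose (C.card - 4) : ℝ))
      = ∑ X ∈ (big4 F).filter (fun C => t ⊆ C), iw univ t X := by
    rw [sum_filter]
    refine sum_congr rfl fun X _ => ?_
    unfold iw
    rw [htc, card_univ, Fintype.card_fin]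
    split_ifs <;> ring
  by_cases hE : ∃ C ∈ big4 F, t ⊆ C
  · obtain ⟨C, hC, htC⟩ := hE
    obtain ⟨c1, S, hS, hSC⟩ := mem_big4.mp hC
    have no : ∀ A : Finset (Fin n), A ⊆ t → A.Nonempty → A.card ≤ 2 → A ∉ F := by
      intro A hA a1 a2 hAF
      have cc := (mem_big3.mp c1).2
      have := lamF hF h0 (mem_big3.mp c1).1 hAF (mem_big3.mp hS).1 a1 (ne_big3 hS)
        ((hA.trans htC).ssubset_of_ne (by rintro rfl; omega)) hSC
      have s3 := (mem_big3.mp hS).2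
      rw [← this] at s3
      omega
    have na : ∀ a ∈ t, alF F a = 0 := by
      intro a ha
      unfold alF
      rw [if_neg (no {a} (by simpa) (by simp) (by simp))]
    have ne : ∀ a ∈ t, ∀ b ∈ t, a ≠ b → nonE (epF F) a b = 1 := by
      intro a ha b hb hab
      have : {a, b} ∉ F := no {a, b} (by simp [insert_subset_iff, ha, hb]) (by simp) card_le_two
      simp [nonE, epF, hab, this]
    have m1 : u ∈ t := by simp [ht]
    have m2 : v ∈ t := by simp [ht]
    have m3 : w ∈ t := by simp [ht]
    have m4 : x ∈ t := by simp [ht]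
    rw [l]
    refine b.trans (le_of_eq ?_)
    unfold tri
    rw [na u m1, na v m2, na w m3, na x m4, ne u m1 v m2 h1, ne u m1 w m3 h2, ne v m2 w m3 h3,
      ne u m1 x m4 h4, ne v m2 x m4 h5, ne w m3 x m4 h6]
    norm_num
  · push Not at hE
    refine le_trans (le_of_eq ?_) r0
    apply sum_eq_zero
    intro C hC
    simp [hE C hC]

end family

section assembly
variable {n : ℕ} {F : Finset (Finset (Fin n))}

lemma exch3 (G : Finset (Finset (Fin n))) (c : Finset (Fin n) → ℝ) :
    ∑ u, ∑ v, ∑ w, d3 u v w * ∑ C ∈ G, chi C u * chi C v * chi C w * c C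
      = ∑ C ∈ G, (C.card : ℝ) * (C.card - 1) * (C.card - 2) * c C := by
  simp only [← cnt3, sum_mul, mul_sum]
  have e : ∀ u v : Fin n, ∑ w, ∑ C ∈ G, d3 u v w * (chi C u * chi C v * chi C w * c C) =
      ∑ C ∈ G, ∑ w, d3 u v w * (chi C u * chi C v * chi C w * c C) := fun u v => sum_comm
  simp only [e]
  have e2 : ∀ u : Fin n, ∑ v, ∑ C ∈ G, ∑ w, d3 u v w * (chi C u * chi C v * chi C w * c C) =
      ∑ C ∈ G, ∑ v, ∑ w, d3 u v w * (chi C u * chi C v * chi C w * c C) := fun u => sum_comm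
  simp only [e2]
  rw [sum_comm]
  refine sum_congr rfl fun C _ => sum_congr rfl fun u _ => sum_congr rfl fun v _ =>
    sum_congr rfl fun w _ => by ring

lemma exch4 (G : Finset (Finset (Fin n))) (c : Finset (Fin n) → ℝ) :
    ∑ u, ∑ v, ∑ w, ∑ x, d4 u v w x * ∑ C ∈ G, chi C u * chi C v * chi C w * chi C x * c C
      = ∑ C ∈ G, (C.card : ℝ) * (C.card - 1) * (C.card - 2) * (C.card - 3) * c C := by
  simp only [← cnt4, sum_mul, mul_sum]
  have e : ∀ u v w : Fin n,
      ∑ x, ∑ C ∈ G, d4 u v w x * (chi C u * chi C v * chi C w * chi C x * c C) =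
      ∑ C ∈ G, ∑ x, d4 u v w x * (chi C u * chi C v * chi C w * chi C x * c C) :=
    fun u v w => sum_comm
  simp only [e]
  have e1 : ∀ u v : Fin n,
      ∑ w, ∑ C ∈ G, ∑ x, d4 u v w x * (chi C u * chi C v * chi C w * chi C x * c C) =
      ∑ C ∈ G, ∑ w, ∑ x, d4 u v w x * (chi C u * chi C v * chi C w * chi C x * c C) :=
    fun u v => sum_comm
  simp only [e1]
  have e2 : ∀ u : Fin n,
      ∑ v, ∑ C ∈ G, ∑ w, ∑ x, d4 u v w x * (chi C u * chi C v * chi C w * chi C x * c C) =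
      ∑ C ∈ G, ∑ v, ∑ w, ∑ x, d4 u v w x * (chi C u * chi C v * chi C w * chi C x * c C) :=
    fun u => sum_comm
  simp only [e2]
  rw [sum_comm]
  refine sum_congr rfl fun C _ => sum_congr rfl fun u _ => sum_congr rfl fun v _ =>
    sum_congr rfl fun w _ => sum_congr rfl fun x _ => by ring

lemma card_le_n (C : Finset (Fin n)) : C.card ≤ n := by
  simpa using card_le_univ C

lemma sumB (hF : DkFree n 2 F) (h0 : ∅ ∈ F) :
    (n : ℝ) * (n - 1) * (n - 2) * (n - 3) * ∑ C ∈ big4 F, 1 / (n.choose C.card : ℝ)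
      ≤ bigQ (alF F) (nonE (epF F)) := by
  have h := exch4 (big4 F) (fun C => 1 / ((n - 4).choose (C.card - 4) : ℝ))
  have e : (n : ℝ) * (n - 1) * (n - 2) * (n - 3) * ∑ C ∈ big4 F, 1 / (n.choose C.card : ℝ) =
      ∑ C ∈ big4 F, (C.card : ℝ) * (C.card - 1) * (C.card - 2) * (C.card - 3) *
        (1 / ((n - 4).choose (C.card - 4) : ℝ)) := by
    rw [mul_sum]
    refine sum_congr rfl fun C hC => ?_
    obtain ⟨c1, S, hS, hSC⟩ := mem_big4.mp hC
    have := card_lt_card hSC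
    have := (mem_big3.mp hS).2
    rw [choose4 n C.card (by omega) (card_le_n C)]
  rw [e, ← h]
  unfold bigQ
  exact sum_le_sum fun u _ => sum_le_sum fun v _ => sum_le_sum fun w _ => sum_le_sum fun x _ =>
    quad_bound hF h0 u v w x

lemma sumA (hn : n ≤ 12) (hn4 : 4 ≤ n) (hF : DkFree n 2 F) (h0 : ∅ ∈ F) :
    (n : ℝ) * (n - 1) * (n - 2) * ∑ C ∈ big3 F, 1 / (n.choose C.card : ℝ)
      ≤ ∑ u, ∑ v, ∑ w, d3 u v w * (if triU (alF F) (epF F) u v w ≤ 1 then (1 : ℝ) else 0)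
      + (n : ℝ) * (n - 1) * (n - 2) * ((∑ C ∈ big4 F, 1 / (n.choose C.card : ℝ)) / 4) := by
  have hnR : (4 : ℝ) ≤ n := by exact_mod_cast hn4
  have hD : (0 : ℝ) ≤ (n : ℝ) * (n - 1) * (n - 2) :=
    mul_nonneg (mul_nonneg (by linarith) (by linarith)) (by linarith)
  have h := exch3 (big3 F) (fun C => 1 / ((n - 3).choose (C.card - 3) : ℝ))
  have e : (n : ℝ) * (n - 1) * (n - 2) * ∑ C ∈ big3 F, 1 / (n.choose C.card : ℝ) =
      ∑ C ∈ big3 F, (C.card : ℝ) * (C.card - 1) * (C.card - 2) *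
        (1 / ((n - 3).choose (C.card - 3) : ℝ)) := by
    rw [mul_sum]
    refine sum_congr rfl fun C hC => ?_
    rw [choose3 n C.card (mem_big3.mp hC).2 (card_le_n C)]
  rw [e, ← h]
  refine (sum_le_sum fun u _ => sum_le_sum fun v _ => sum_le_sum fun w _ =>
    triple_bound hF h0 u v w).trans ?_
  simp only [mul_add, sum_add_distrib]
  refine add_le_add_right ?_ _
  -- pull the sum over C outside
  have p : ∑ u, ∑ v, ∑ w, d3 u v w * ∑ C ∈ big3 F, ∑ S ∈ (big3 F).filter (fun S => S ⊂ C),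
      chi S u * chi S v * chi S w * (1 / ((n - 3).choose (C.card - 3) : ℝ) *
        (1 / ((C.card - 3).choose (S.card - 3) : ℝ)))
      = ∑ C ∈ big3 F, ∑ u, ∑ v, ∑ w, d3 u v w * ∑ S ∈ (big3 F).filter (fun S => S ⊂ C),
      chi S u * chi S v * chi S w * (1 / ((n - 3).choose (C.card - 3) : ℝ) *
        (1 / ((C.card - 3).choose (S.card - 3) : ℝ))) := by
    symm
    rw [sum_comm]
    refine sum_congr rfl fun u _ => ?_
    rw [sum_comm]
    refine sum_congr rfl fun v _ => ?_
    rw [sum_comm]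
    refine sum_congr rfl fun w _ => ?_
    rw [mul_sum]
  rw [p]
  have q : ∀ C ∈ big3 F, ∑ u, ∑ v, ∑ w, d3 u v w * ∑ S ∈ (big3 F).filter (fun S => S ⊂ C),
      chi S u * chi S v * chi S w * (1 / ((n - 3).choose (C.card - 3) : ℝ) *
        (1 / ((C.card - 3).choose (S.card - 3) : ℝ)))
      ≤ if ∃ S ∈ big3 F, S ⊂ C then
        (n : ℝ) * (n - 1) * (n - 2) * ((1 / (n.choose C.card : ℝ)) / 4) else 0 := by
    intro C hC
    rw [exch3 ((big3 F).filter (fun S => S ⊂ C)) (fun S => 1 / ((n - 3).choose (C.card - 3) : ℝ) *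
        (1 / ((C.card - 3).choose (S.card - 3) : ℝ)))]
    have r : ∀ S ∈ (big3 F).filter (fun S => S ⊂ C), (S.card : ℝ) * (S.card - 1) * (S.card - 2) *
        (1 / ((n - 3).choose (C.card - 3) : ℝ) * (1 / ((C.card - 3).choose (S.card - 3) : ℝ))) ≤
        (n : ℝ) * (n - 1) * (n - 2) * ((1 / (n.choose C.card : ℝ)) / 4) := by
      intro S hS
      obtain ⟨hS3, hSC⟩ := mem_filter.mp hS
      have s3 := (mem_big3.mp hS3).2
      have slt := card_lt_card hSC
      have cn := card_le_n C
      have i1 := choose3 C.card S.card s3 slt.le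
      have i2 := choose3 n C.card (by omega) cn
      have e : (S.card : ℝ) * (S.card - 1) * (S.card - 2) *
        (1 / ((n - 3).choose (C.card - 3) : ℝ) * (1 / ((C.card - 3).choose (S.card - 3) : ℝ))) =
        (n : ℝ) * (n - 1) * (n - 2) * (1 / (n.choose C.card : ℝ) *
          (1 / (C.card.choose S.card : ℝ))) := by
        calc _ = ((S.card : ℝ) * (S.card - 1) * (S.card - 2) *
            (1 / ((C.card - 3).choose (S.card - 3) : ℝ))) *
            (1 / ((n - 3).choose (C.card - 3) : ℝ)) := by ring
          _ = ((C.card : ℝ) * (C.card - 1) * (C.card - 2) *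
            (1 / ((n - 3).choose (C.card - 3) : ℝ))) * (1 / (C.card.choose S.card : ℝ)) := by
            rw [i1]; ring
          _ = _ := by rw [i2]; ring
      rw [e]
      have g : 4 ≤ C.card.choose S.card :=
        choose_ge4 ⟨C.card, by omega⟩ ⟨S.card, by omega⟩ s3 slt
      have g' : (4 : ℝ) ≤ (C.card.choose S.card : ℝ) := by exact_mod_cast g
      apply mul_le_mul_of_nonneg_left _ hD
      rw [div_eq_mul_one_div (1 / (n.choose C.card : ℝ)) 4]
      apply mul_le_mul_of_nonneg_left _ (by positivity)
      exact one_div_le_one_div_of_le (by norm_num) g'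
    split_ifs with hE
    · obtain ⟨S, hS, hSC⟩ := hE
      have hf : (big3 F).filter (fun S => S ⊂ C) = {S} := by
        ext S'
        rw [mem_filter, mem_singleton]
        constructor
        · rintro ⟨a, b⟩
          exact lamF hF h0 (mem_big3.mp hC).1 (mem_big3.mp a).1 (mem_big3.mp hS).1
            (ne_big3 a) (ne_big3 hS) b hSC
        · rintro rfl; exact ⟨hS, hSC⟩
      have := r S (mem_filter.mpr ⟨hS, hSC⟩)
      rw [hf, sum_singleton]
      exact this
    · have hf : (big3 F).filter (fun S => S ⊂ C) = ∅ := by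
        rw [filter_eq_empty_iff]
        intro S hS hSC
        exact hE ⟨S, hS, hSC⟩
      rw [hf, sum_empty]
  refine (sum_le_sum q).trans (le_of_eq ?_)
  rw [← sum_filter]
  change ∑ C ∈ big4 F, (n : ℝ) * (n - 1) * (n - 2) * ((1 / (n.choose C.card : ℝ)) / 4) = _
  rw [sum_div, mul_sum]

lemma sum1 : ∑ A ∈ F.filter (fun A => A.card = 1), 1 / (n.choose A.card : ℝ)
    = (∑ u, alF F u) / n := by
  have e : ∀ u, alF F u = ∑ A ∈ F.filter (fun A => A.card = 1), chi A u := by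
    intro u
    unfold alF
    split_ifs with h
    · symm
      rw [sum_eq_single {u}]
      · simp [chi]
      · intro A hA hne
        obtain ⟨_, hc⟩ := mem_filter.mp hA
        obtain ⟨a, rfl⟩ := card_eq_one.mp hc
        have : u ≠ a := by rintro rfl; exact hne rfl
        simp [chi, this]
      · intro hn; exact absurd (mem_filter.mpr ⟨h, by simp⟩) hn
    · symm
      apply sum_eq_zero
      intro A hA
      obtain ⟨hAF, hc⟩ := mem_filter.mp hA
      obtain ⟨a, rfl⟩ := card_eq_one.mp hc
      have : u ≠ a := by rintro rfl; exact h hAF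
      simp [chi, this]
  simp only [e]
  rw [sum_comm, sum_div]
  refine sum_congr rfl fun A hA => ?_
  rw [chi_sum, (mem_filter.mp hA).2]
  simp

lemma sum2 (hn : 4 ≤ n) : ∑ A ∈ F.filter (fun A => A.card = 2), 1 / (n.choose A.card : ℝ)
    = (∑ u, ∑ v, ne2 u v * epF F u v) / (n * (n - 1)) := by
  have e : ∀ u v, ne2 u v * epF F u v =
      ∑ A ∈ F.filter (fun A => A.card = 2), ne2 u v * (chi A u * chi A v) := by
    intro u v
    by_cases huv : u = v
    · simp [ne2, huv]
    have key : ∀ A : Finset (Fin n), A.card = 2 → u ∈ A → v ∈ A → A = {u, v} := by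
      intro A hA hu hv
      symm
      apply eq_of_subset_of_card_le
      · simp [insert_subset_iff, hu, hv]
      · rw [hA, card_pair huv]
    have z : ∀ A : Finset (Fin n), A.card = 2 → A ≠ {u, v} → chi A u * chi A v = 0 := by
      intro A hA hne
      unfold chi
      by_cases h1 : u ∈ A <;> by_cases h2 : v ∈ A <;> simp [h1, h2]
      exact hne (key A hA h1 h2)
    rw [← mul_sum]
    congr 1
    unfold epF
    simp only [ne_eq, huv, not_false_eq_true, true_and]
    split_ifs with h
    · symm
      rw [sum_eq_single {u, v}]
      · simp [chi]
      · intro A hA hne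
        exact z A (mem_filter.mp hA).2 hne
      · intro hn; exact absurd (mem_filter.mpr ⟨h, card_pair huv⟩) hn
    · symm
      apply sum_eq_zero
      intro A hA
      obtain ⟨hAF, hc⟩ := mem_filter.mp hA
      exact z A hc (by rintro rfl; exact h hAF)
  simp only [e]
  have e2 : ∀ u : Fin n, ∑ v, ∑ A ∈ F.filter (fun A => A.card = 2), ne2 u v * (chi A u * chi A v) =
      ∑ A ∈ F.filter (fun A => A.card = 2), ∑ v, ne2 u v * (chi A u * chi A v) :=
    fun u => sum_comm
  simp only [e2]
  rw [sum_comm, sum_div]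
  refine sum_congr rfl fun A hA => ?_
  rw [cnt2, (mem_filter.mp hA).2, Nat.cast_choose_two]
  have hnR : (4 : ℝ) ≤ n := by exact_mod_cast hn
  have h1 : (n : ℝ) ≠ 0 := by linarith
  have h2 : (n : ℝ) - 1 ≠ 0 := by linarith
  push_cast
  field_simp
  norm_num

lemma lubell_split (h0 : ∅ ∈ F) : lubell n F = 1
    + ∑ A ∈ F.filter (fun A => A.card = 1), 1 / (n.choose A.card : ℝ)
    + ∑ A ∈ F.filter (fun A => A.card = 2), 1 / (n.choose A.card : ℝ)
    + ∑ A ∈ big3 F, 1 / (n.choose A.card : ℝ) := by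
  have z : ∑ A ∈ F.filter (fun A => A.card = 0), 1 / (n.choose A.card : ℝ) = 1 := by
    have : F.filter (fun A => A.card = 0) = {∅} := by
      ext A
      rw [mem_filter, card_eq_zero, mem_singleton]
      constructor
      · exact fun h => h.2
      · rintro rfl; exact ⟨h0, rfl⟩
    rw [this]; simp
  have main : lubell n F = ∑ A ∈ F.filter (fun A => A.card = 0), 1 / (n.choose A.card : ℝ)
    + ∑ A ∈ F.filter (fun A => A.card = 1), 1 / (n.choose A.card : ℝ)
    + ∑ A ∈ F.filter (fun A => A.card = 2), 1 / (n.choose A.card : ℝ)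
    + ∑ A ∈ big3 F, 1 / (n.choose A.card : ℝ) := by
    unfold lubell big3
    simp only [sum_filter]
    rw [← sum_add_distrib, ← sum_add_distrib, ← sum_add_distrib]
    refine sum_congr rfl fun A _ => ?_
    generalize 1 / (n.choose A.card : ℝ) = y
    rcases Nat.lt_or_ge A.card 3 with h | h
    · have : A.card = 0 ∨ A.card = 1 ∨ A.card = 2 := by omega
      rcases this with h | h | h <;> simp [h]
    · have h1 : A.card ≠ 0 := by omega
      have h2 : A.card ≠ 1 := by omega
      have h3 : A.card ≠ 2 := by omega
      rw [if_neg h1, if_neg h2, if_neg h3, if_pos h]; ring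
  rw [main, z]

end assembly

/-- For `4 ≤ n ≤ 12`, every diamond-free family of subsets of `[n]` containing
`∅` has Lubell function at most `2 + ⌈n/2⌉⌊n/2⌋/(n(n-1))`. -/
theorem lubell_le_small_n (n : ℕ) (hn4 : 4 ≤ n) (hn12 : n ≤ 12)
    (F : Finset (Finset (Fin n))) (hF : DkFree n 2 F) (h0 : ∅ ∈ F) :
    lubell n F ≤ 2 + (((n + 1) / 2 : ℕ) : ℝ) * ((n / 2 : ℕ) : ℝ) /
      ((n : ℝ) * ((n : ℝ) - 1)) := by
  have hnR : (4 : ℝ) ≤ n := by exact_mod_cast hn4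
  have p0 : (0 : ℝ) < n := by linarith
  have p1 : (0 : ℝ) < (n : ℝ) - 1 := by linarith
  have p2 : (0 : ℝ) < (n : ℝ) - 2 := by linarith
  have p3 : (0 : ℝ) < (n : ℝ) - 3 := by linarith
  have hA := sumA hn12 hn4 hF h0
  have hB := sumB hF h0
  have hP := partTwo (α := alF F) (ε := epF F) hn4 hn12
    (by intro u; unfold alF; split_ifs <;> simp)
    (by intro u v; unfold epF; split_ifs <;> simp)
    (by intro u v; unfold epF; rw [pair_comm u v]; simp only [ne_comm])
    (by
      intro u v huv a b
      have ha : {u} ∈ F := by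
        by_contra h; simp [alF, h] at a
      have hb : {v} ∈ F := by
        by_contra h; simp [alF, h] at b
      unfold epF
      rw [if_neg]
      rintro ⟨_, hc⟩
      have hcard := card_pair huv
      have := lamF hF h0 hc ha hb (by simp) (by simp)
        (ssubset_of_subset_of_ne (by simp) (by intro h; rw [← h] at hcard; simp at hcard))
        (ssubset_of_subset_of_ne (by simp) (by intro h; rw [← h] at hcard; simp at hcard))
      exact huv (by simpa using this))
  have hS := d3_sum_triU (alF F) (epF F)
  have hO := d3_sum_one (n := n)
  rw [lubell_split h0, sum1, sum2 hn4]
  have eT : ∑ u, ∑ v, ∑ w, d3 u v w * (triU (alF F) (epF F) u v w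
      + 3 * (if triU (alF F) (epF F) u v w ≤ 1 then (1 : ℝ) else 0) - 3) =
      ∑ u, ∑ v, ∑ w, d3 u v w * triU (alF F) (epF F) u v w
      + 3 * ∑ u, ∑ v, ∑ w, d3 u v w * (if triU (alF F) (epF F) u v w ≤ 1 then (1 : ℝ) else 0)
      - 3 * ∑ u : Fin n, ∑ v : Fin n, ∑ w : Fin n, d3 u v w := by
    simp only [mul_sum, ← sum_add_distrib, ← sum_sub_distrib]
    exact sum_congr rfl fun u _ => sum_congr rfl fun v _ => sum_congr rfl fun w _ => by ring
  rw [eT, hS, hO] at hP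
  generalize ∑ u, ∑ v, ∑ w, d3 u v w * (if triU (alF F) (epF F) u v w ≤ 1 then (1 : ℝ) else 0) = T
    at hA hP
  generalize ∑ C ∈ big3 F, 1 / (n.choose C.card : ℝ) = X at hA ⊢
  generalize ∑ C ∈ big4 F, 1 / (n.choose C.card : ℝ) = Y at hA hB
  generalize bigQ (alF F) (nonE (epF F)) = Q at hB hP
  generalize ∑ u, alF F u = a at hP ⊢
  generalize ∑ u, ∑ v, ne2 u v * epF F u v = b at hP ⊢
  generalize (((n + 1) / 2 : ℕ) : ℝ) * ((n / 2 : ℕ) : ℝ) = K at hP ⊢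
  have hQ : (n : ℝ) * (n - 1) * (n - 2) * (Y / 4) ≤ Q / (4 * (n - 3)) := by
    rw [le_div_iff₀ (by linarith)]
    linarith
  have fin : (n : ℝ) * (n - 1) * (n - 2) * X + a * (n - 1) * (n - 2) + b * (n - 2)
      ≤ K * (n - 2) + (n : ℝ) * (n - 1) * (n - 2) := by linarith
  have fin2 : (n : ℝ) * (n - 1) * X + a * (n - 1) + b ≤ K + (n : ℝ) * (n - 1) := by
    apply le_of_mul_le_mul_right _ p2
    linarith
  have hpp : (0 : ℝ) < n * (n - 1) := mul_pos p0 p1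
  have e1 : 1 + a / n + b / (n * (n - 1)) + X =
      1 + ((n : ℝ) * (n - 1) * X + a * (n - 1) + b) / (n * (n - 1)) := by
    field_simp
    ring
  have e2 : 2 + K / ((n : ℝ) * (n - 1)) = 1 + (K + (n : ℝ) * (n - 1)) / (n * (n - 1)) := by
    field_simp
    ring
  rw [e1, e2]
  exact add_le_add_right (div_le_div_of_nonneg_right fin2 hpp.le) 1
end

section
/- Let n ≥ 2 and 0 < s < n, and let S, T partition [n] with |S| = s and |T| = n − s. Then the family C_1(S,T) = {∅} ∪ {{x} : x ∈ S} ∪ {{x,y} : x ∈ S, y ∈ T} ∪ {{y,y'} : y, y' ∈ T, y ≠ y'} is diamond-free, and its Lubell function equals h̄(C_1(S,T)) = 2 + s(n−s)/(n(n−1)). -/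
open Finset

/-- Construction `C₁(S,T)`:
`{∅} ∪ {{x} : x ∈ S} ∪ {{x,y} : x ∈ S, y ∈ T} ∪ {2-subsets of T}`. -/
def constrC1 (n : ℕ) (S T : Finset (Fin n)) : Finset (Finset (Fin n)) :=
  {∅} ∪ S.image (fun x => ({x} : Finset (Fin n))) ∪
    (S ×ˢ T).image (fun p => ({p.1, p.2} : Finset (Fin n))) ∪
    T.powersetCard 2

/-- For a partition `[n] = S ∪ T` with `|S| = s`, `0 < s < n`, the family
`C₁(S,T)` is diamond-free and its Lubell function is `2 + s(n-s)/(n(n-1))`. -/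
theorem constrC1_diamondFree_lubell (n s : ℕ) (hn : 2 ≤ n)
    (hs0 : 0 < s) (hsn : s < n)
    (S T : Finset (Fin n)) (hST : Disjoint S T)
    (hunion : S ∪ T = Finset.univ) (hcard : S.card = s) :
    DkFree n 2 (constrC1 n S T) ∧
    lubell n (constrC1 n S T) =
      2 + (s : ℝ) * ((n : ℝ) - s) / ((n : ℝ) * ((n : ℝ) - 1)) := by
  have hdis : ∀ x ∈ S, x ∉ T := fun x hx hy => Finset.disjoint_left.mp hST hx hy
  have hpair : ∀ x ∈ S, ∀ y ∈ T, ({x, y} : Finset (Fin n)).card = 2 := by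
    intro x hx y hy
    apply Finset.card_pair
    rintro rfl
    exact hdis _ hx hy
  have hTcard : T.card = n - s := by
    have h := Finset.card_union_of_disjoint hST
    rw [hunion, Finset.card_univ, Fintype.card_fin, hcard] at h
    omega
  constructor
  · have key : ∀ X ∈ constrC1 n S T, X.card = 0 ∨ (X.card = 1 ∧ X ⊆ S) ∨
        (X.card = 2 ∧ ∃ y ∈ X, y ∈ T) := by
      intro X hX
      simp only [constrC1, Finset.mem_union, Finset.mem_singleton, Finset.mem_image,
        Finset.mem_powersetCard, Finset.mem_product] at hX
      rcases hX with ((rfl | ⟨x, hx, rfl⟩) | ⟨⟨x, y⟩, ⟨hx, hy⟩, rfl⟩) | ⟨h1, h2⟩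
      · simp
      · right; left; simpa using hx
      · right; right
        exact ⟨hpair x hx y hy, y, by simp, hy⟩
      · right; right
        obtain ⟨y, hy⟩ := Finset.card_pos.mp (by omega : 0 < X.card)
        exact ⟨h2, y, hy, h1 hy⟩
    rintro ⟨A, C, B, hA, hC, hB, hinj, hne, hAC, hsub⟩
    have lt1 : ∀ i, A.card < (B i).card := fun i =>
      Finset.card_lt_card ((hsub i).1.ssubset_of_ne (hne i).1.symm)
    have lt2 : ∀ i, (B i).card < C.card := fun i =>
      Finset.card_lt_card ((hsub i).2.ssubset_of_ne (hne i).2)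
    have hC2 : C.card = 2 ∧ ∃ y ∈ C, y ∈ T := by
      have := lt1 0
      have := lt2 0
      rcases key C hC with h | h | h
      · omega
      · omega
      · exact h
    have hB1 : ∀ i, (B i).card = 1 ∧ B i ⊆ S := by
      intro i
      have := lt1 i
      have := lt2 i
      rcases key _ (hB i) with h | h | h
      · omega
      · exact h
      · omega
    have hlt : (B 0).card < (B 0 ∪ B 1).card := by
      apply Finset.card_lt_card
      refine Finset.subset_union_left.ssubset_of_ne ?_
      intro h
      have h10 : B 1 ⊆ B 0 := h ▸ Finset.subset_union_right
      have := Finset.eq_of_subset_of_card_le h10 (by rw [(hB1 0).1, (hB1 1).1])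
      exact absurd (hinj this) (by decide)
    have hU : B 0 ∪ B 1 = C := by
      apply Finset.eq_of_subset_of_card_le (Finset.union_subset (hsub 0).2 (hsub 1).2)
      have := (hB1 0).1
      omega
    obtain ⟨_, y, hy, hyT⟩ := hC2
    rw [← hU] at hy
    exact hdis y (Finset.union_subset (hB1 0).2 (hB1 1).2 hy) hyT
  · have hnR : (2 : ℝ) ≤ n := by exact_mod_cast hn
    unfold lubell constrC1
    rw [Finset.sum_union, Finset.sum_union, Finset.sum_union]
    · have e1 : ∑ A ∈ S.image (fun x => ({x} : Finset (Fin n))), (1 : ℝ) / (n.choose A.card)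
          = s * (1 / n) := by
        rw [Finset.sum_image (fun a _ b _ h => Finset.singleton_injective h)]
        simp [hcard]
      have hc2 : (n.choose 2 : ℝ) = n * (n - 1) / 2 := Nat.cast_choose_two ℝ n
      have ht : ((n - s : ℕ) : ℝ) = n - s := by push_cast [hsn.le]; ring
      have e2 : ∑ A ∈ (S ×ˢ T).image (fun p => ({p.1, p.2} : Finset (Fin n))),
          (1 : ℝ) / (n.choose A.card) = s * (n - s) * (1 / (n * (n - 1) / 2)) := by
        rw [Finset.sum_image]
        · rw [Finset.sum_congr rfl (g := fun _ => (1 : ℝ) / (n * (n - 1) / 2))]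
          · rw [Finset.sum_const, Finset.card_product, hcard, hTcard, nsmul_eq_mul,
              Nat.cast_mul, ht]
          · rintro ⟨x, y⟩ hp
            rw [Finset.mem_product] at hp
            rw [hpair x hp.1 y hp.2, hc2]
        · rintro ⟨x, y⟩ hp ⟨x', y'⟩ hp' h
          simp only [Finset.coe_product, Set.mem_prod, Finset.mem_coe] at hp hp'
          have h1 : x ∈ ({x', y'} : Finset (Fin n)) := by
            rw [← show ({x, y} : Finset (Fin n)) = {x', y'} from h]; simp
          have h2 : y ∈ ({x', y'} : Finset (Fin n)) := by
            rw [← show ({x, y} : Finset (Fin n)) = {x', y'} from h]; simp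
          simp only [Finset.mem_insert, Finset.mem_singleton] at h1 h2
          have hx : x = x' := h1.resolve_right (fun e => hdis x hp.1 (e ▸ hp'.2))
          have hy : y = y' := h2.resolve_left (fun e => hdis x' hp'.1 (e ▸ hp.2))
          rw [hx, hy]
      have e3 : ∑ A ∈ T.powersetCard 2, (1 : ℝ) / (n.choose A.card)
          = ((n - s) * (n - s - 1) / 2) * (1 / (n * (n - 1) / 2)) := by
        rw [Finset.sum_congr rfl (g := fun _ => (1 : ℝ) / (n * (n - 1) / 2))]
        · rw [Finset.sum_const, Finset.card_powersetCard, hTcard, nsmul_eq_mul,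
            Nat.cast_choose_two, ht]
        · intro A hA
          rw [(Finset.mem_powersetCard.mp hA).2, hc2]
      rw [e1, e2, e3]
      have h0 : (n : ℝ) ≠ 0 := by linarith
      have h1 : (n : ℝ) - 1 ≠ 0 := by linarith
      simp only [Finset.sum_singleton, Finset.card_empty, Nat.choose_zero_right, Nat.cast_one]
      field_simp
      ring
    · simp
    · rw [Finset.disjoint_left]
      intro X hX hX'
      obtain ⟨⟨x, y⟩, hp, rfl⟩ := Finset.mem_image.mp hX'
      rw [Finset.mem_product] at hp
      have h2 := hpair x hp.1 y hp.2
      rcases Finset.mem_union.mp hX with h | h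
      · rw [Finset.mem_singleton] at h
        simp only at h
        rw [h] at h2; simp at h2
      · obtain ⟨z, _, hz⟩ := Finset.mem_image.mp h
        simp only at hz
        rw [← hz] at h2; simp at h2
    · rw [Finset.disjoint_left]
      intro X hX hX'
      obtain ⟨hs, h2⟩ := Finset.mem_powersetCard.mp hX'
      rcases Finset.mem_union.mp hX with h | h
      · rcases Finset.mem_union.mp h with h | h
        · rw [Finset.mem_singleton] at h
          rw [h] at h2; simp at h2
        · obtain ⟨z, _, hz⟩ := Finset.mem_image.mp h
          rw [← hz] at h2; simp at h2
      · obtain ⟨⟨x, y⟩, hp, rfl⟩ := Finset.mem_image.mp h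
        rw [Finset.mem_product] at hp
        exact hdis x hp.1 (hs (by simp))
end
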